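/- arXiv:2010.01076 — 2 statements merged into one kernel-verified Lean document; each statement's English description precedes it below -/
import Mathlib

section
/- The following set identities hold: D = {(1/2) h(λ)⁻¹ [λ](I_L^* + r·1) : λ ∈ Λ₁, r > 0}; cl D = {(1/2) h(λ)⁻¹ [λ](I_L^* + r·1) : λ ∈ Λ₁, r ≥ 0}; and ∂D = {φ(λ) : λ ∈ Λ₁}. Moreover, the map (λ, r) ↦ (1/2) h(λ)⁻¹ [λ](I_L^* + r·1) is a homeomorphism from Λ₁ × [0, ∞) onto cl D, and the sets D, cl D, and ∂D are simply connected. -/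
open Matrix Set

noncomputable section

/-- `A` is irreducible: for every nonempty proper subset `α` of the index set,
the submatrix `A[α, αᶜ]` is not the zero matrix. -/
def IsIrred {k : ℕ} (A : Matrix (Fin k) (Fin k) ℝ) : Prop :=
  ∀ α : Finset (Fin k), α.Nonempty → α ≠ Finset.univ → ∃ i ∈ α, ∃ j ∈ αᶜ, A i j ≠ 0

/-- `A` is a Z-matrix: off-diagonal entries are nonpositive. -/
def IsZmat {k : ℕ} (A : Matrix (Fin k) (Fin k) ℝ) : Prop :=
  ∀ i j, i ≠ j → A i j ≤ 0

/-- `A` is an M-matrix: a Z-matrix all of whose eigenvalues have nonnegative real part. -/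
def IsMmat {k : ℕ} (A : Matrix (Fin k) (Fin k) ℝ) : Prop :=
  IsZmat A ∧ ∀ μ ∈ spectrum ℂ (A.map (Complex.ofReal)), 0 ≤ μ.re

/-- `A` is a nonsingular M-matrix: a Z-matrix all of whose eigenvalues have positive real part. -/
def IsNonsingMmat {k : ℕ} (A : Matrix (Fin k) (Fin k) ℝ) : Prop :=
  IsZmat A ∧ ∀ μ ∈ spectrum ℂ (A.map (Complex.ofReal)), 0 < μ.re

/-- `P_c(x) = [x] Y (V* − x)`. -/
def Pc {k : ℕ} (Y : Matrix (Fin k) (Fin k) ℝ) (Vs : Fin k → ℝ) (x : Fin k → ℝ) : Fin k → ℝ :=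
  Matrix.diagonal x *ᵥ (Y *ᵥ (Vs - x))

/-- Jacobian of `P_c` at `x`: `J(x) = [Y(V* − x)] − [x] Y`. -/
def Jmat {k : ℕ} (Y : Matrix (Fin k) (Fin k) ℝ) (Vs : Fin k → ℝ) (x : Fin k → ℝ) :
    Matrix (Fin k) (Fin k) ℝ :=
  Matrix.diagonal (Y *ᵥ (Vs - x)) - Matrix.diagonal x * Y

/-- long-term voltage stable operating points. -/
def Dset {k : ℕ} (Y : Matrix (Fin k) (Fin k) ℝ) (Vs : Fin k → ℝ) : Set (Fin k → ℝ) :=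
  {x | (∀ i, 0 < x i) ∧ IsUnit (Jmat Y Vs x).det ∧ ∀ i j, (Jmat Y Vs x)⁻¹ i j < 0}

/-- feasible power demands. -/
def Fset {k : ℕ} (Y : Matrix (Fin k) (Fin k) ℝ) (Vs : Fin k → ℝ) : Set (Fin k → ℝ) :=
  {P | ∃ x, (∀ i, 0 < x i) ∧ Pc Y Vs x = P}

/-- `h(λ) = (1/2)([λ] Y + Y [λ])`. -/
def hmat {k : ℕ} (Y : Matrix (Fin k) (Fin k) ℝ) (l : Fin k → ℝ) : Matrix (Fin k) (Fin k) ℝ :=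
  (1/2 : ℝ) • (Matrix.diagonal l * Y + Y * Matrix.diagonal l)

/-- `Λ₁ = {λ ∈ Λ : λ > 0, 1ᵀλ = 1}`. -/
def Lam1 {k : ℕ} (Y : Matrix (Fin k) (Fin k) ℝ) : Set (Fin k → ℝ) :=
  {l | (hmat Y l).PosDef ∧ (∀ i, 0 < l i) ∧ ∑ i, l i = 1}

/-- `φ(λ) = (1/2) h(λ)⁻¹ [λ] I*` where `I* = Y V*`. -/
def phiv {k : ℕ} (Y : Matrix (Fin k) (Fin k) ℝ) (Vs : Fin k → ℝ) (l : Fin k → ℝ) : Fin k → ℝ :=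
  (1/2 : ℝ) • ((hmat Y l)⁻¹ *ᵥ (Matrix.diagonal l *ᵥ (Y *ᵥ Vs)))

/-- `‖x‖_{h(λ)}²  = xᵀ h(λ) x`. -/
def qnorm {k : ℕ} (Y : Matrix (Fin k) (Fin k) ℝ) (l x : Fin k → ℝ) : ℝ :=
  x ⬝ᵥ (hmat Y l *ᵥ x)

/-- The half-space `H_λ`. -/
def Hset {k : ℕ} (Y : Matrix (Fin k) (Fin k) ℝ) (Vs : Fin k → ℝ) (l : Fin k → ℝ) :
    Set (Fin k → ℝ) :=
  {y | l ⬝ᵥ y ≤ qnorm Y l (phiv Y Vs l)}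

/-- `(1/2) h(λ)⁻¹ [λ](I* + r·1)` with `I* = Y V*`. -/
def PhiD {k : ℕ} (Y : Matrix (Fin k) (Fin k) ℝ) (Vs : Fin k → ℝ) (l : Fin k → ℝ) (r : ℝ) :
    Fin k → ℝ :=
  (1/2 : ℝ) • ((hmat Y l)⁻¹ *ᵥ (Matrix.diagonal l *ᵥ (Y *ᵥ Vs + r • (1 : Fin k → ℝ))))

lemma aux_zero {n : ℕ} {B : Matrix (Fin n) (Fin n) ℝ} (hZ : IsZmat B) (hI : IsIrred B)
    (y : Fin n → ℝ) (hy : ∀ i, 0 ≤ y i) (h : ∀ i, y i = 0 → 0 ≤ (B *ᵥ y) i) :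
    y = 0 ∨ ∀ i, 0 < y i := by
  by_cases h1 : (Finset.univ.filter (fun i => y i = 0)).Nonempty
  · by_cases h2 : (Finset.univ.filter (fun i => y i = 0)) = Finset.univ
    · left
      funext i
      have : i ∈ (Finset.univ.filter (fun i => y i = 0)) := by rw [h2]; simp
      simpa using this
    · exfalso
      obtain ⟨i, hi, j, hj, hij⟩ := hI _ h1 h2
      simp at hi hj
      have hne : i ≠ j := by rintro rfl; exact hj hi
      have hlt : (B *ᵥ y) i < 0 := by
        have : (B *ᵥ y) i = ∑ k, B i k * y k := rfl
        rw [this]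
        apply Finset.sum_neg' 
        · intro k _
          by_cases hk : i = k
          · subst hk; simp [hi]
          · exact mul_nonpos_of_nonpos_of_nonneg (hZ i k hk) (hy k)
        · refine ⟨j, Finset.mem_univ _, ?_⟩
          exact mul_neg_of_neg_of_pos (lt_of_le_of_ne (hZ i j hne) hij)
            (lt_of_le_of_ne (hy j) (Ne.symm hj))
      linarith [h i hi]
  · right
    intro i
    refine lt_of_le_of_ne (hy i) fun h0 => h1 ⟨i, by simp [← h0]⟩

lemma aux_min {n : ℕ} (hn : 1 ≤ n) (u x : Fin n → ℝ) (hu : ∀ i, 0 < u i) :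
    ∃ s : ℝ, (∀ i, 0 ≤ x i - s * u i) ∧ ∃ i, x i = s * u i := by
  have : Nonempty (Fin n) := ⟨⟨0, hn⟩⟩
  obtain ⟨i, hi⟩ := Finite.exists_min (fun i => x i / u i)
  refine ⟨x i / u i, fun j => ?_, i, ?_⟩
  · have := (le_div_iff₀ (hu j)).1 (hi j)
    linarith
  · have := (hu i).ne'
    field_simp

lemma aux_dich {n : ℕ} (hn : 1 ≤ n) {B : Matrix (Fin n) (Fin n) ℝ} (hZ : IsZmat B) (hI : IsIrred B)
    (u : Fin n → ℝ) (hu : ∀ i, 0 < u i) (hBu : ∀ i, 0 ≤ (B *ᵥ u) i) (hBu0 : B *ᵥ u ≠ 0)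
    (x : Fin n → ℝ) (hx : ∀ i, 0 ≤ (B *ᵥ x) i) : x = 0 ∨ ∀ i, 0 < x i := by
  obtain ⟨s, hs, i, hi⟩ := aux_min hn u x hu
  rcases lt_or_ge 0 s with h0 | h0
  · right
    intro j
    have := mul_pos h0 (hu j)
    linarith [hs j]
  · have hB : ∀ j, (B *ᵥ (x - s • u)) j = (B *ᵥ x) j - s * (B *ᵥ u) j := by
      intro j; rw [mulVec_sub, mulVec_smul]; simp
    rcases aux_zero hZ hI (x - s • u) (by simpa using hs) (by
      intro j _
      rw [hB]
      have := mul_nonpos_of_nonpos_of_nonneg h0 (hBu j)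
      linarith [hx j]) with h | h
    · left
      have hs0 : s = 0 := by
        by_contra hne
        apply hBu0
        funext j
        have h1 := hB j
        rw [h] at h1
        simp at h1
        have h2 := hx j
        have h3 := hBu j
        have h4 : s < 0 := lt_of_le_of_ne h0 hne
        simp
        nlinarith
      simpa [hs0] using h
    · have := h i
      simp [hi] at this

lemma aux_unit {n : ℕ} (hn : 1 ≤ n) {B : Matrix (Fin n) (Fin n) ℝ} (hZ : IsZmat B) (hI : IsIrred B)
    (u : Fin n → ℝ) (hu : ∀ i, 0 < u i) (hBu : ∀ i, 0 ≤ (B *ᵥ u) i) (hBu0 : B *ᵥ u ≠ 0) :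
    IsUnit B := by
  rw [← Matrix.mulVec_injective_iff_isUnit]
  intro a b hab
  have h0 : B *ᵥ (a - b) = 0 := by rw [mulVec_sub]; exact sub_eq_zero.2 hab
  have h0' : B *ᵥ (b - a) = 0 := by rw [mulVec_sub]; exact sub_eq_zero.2 hab.symm
  rcases aux_dich hn hZ hI u hu hBu hBu0 (a - b) (by simp [h0]) with h | h
  · exact sub_eq_zero.1 h
  rcases aux_dich hn hZ hI u hu hBu hBu0 (b - a) (by simp [h0']) with h' | h'
  · exact (sub_eq_zero.1 h').symm
  have h1 := h ⟨0, hn⟩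
  have h2 := h' ⟨0, hn⟩
  simp at h1 h2
  linarith

lemma aux_inv {n : ℕ} (hn : 1 ≤ n) {B : Matrix (Fin n) (Fin n) ℝ} (hZ : IsZmat B) (hI : IsIrred B)
    (u : Fin n → ℝ) (hu : ∀ i, 0 < u i) (hBu : ∀ i, 0 ≤ (B *ᵥ u) i) (hBu0 : B *ᵥ u ≠ 0)
    (i j : Fin n) : 0 < B⁻¹ i j := by
  have hU := aux_unit hn hZ hI u hu hBu hBu0
  have hU' := (Matrix.isUnit_iff_isUnit_det B).1 hU
  have he : B *ᵥ (B⁻¹ *ᵥ Pi.single j 1) = Pi.single j 1 := by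
    rw [mulVec_mulVec, Matrix.mul_nonsing_inv _ hU', one_mulVec]
  have hij : (B⁻¹ *ᵥ Pi.single j 1) i = B⁻¹ i j := by simp
  rw [← hij]
  rcases aux_dich hn hZ hI u hu hBu hBu0 (B⁻¹ *ᵥ Pi.single j 1) (by
    rw [he]; intro k; by_cases hk : k = j
    · subst hk; simp
    · simp [hk]) with h | h
  · rw [h, mulVec_zero] at he
    have := congrFun he j
    simp at this
  · exact h i

lemma aux_pd {n : ℕ} (hn : 1 ≤ n) {B : Matrix (Fin n) (Fin n) ℝ} (hZ : IsZmat B) (hI : IsIrred B)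
    (hS : ∀ i j, B i j = B j i)
    (u : Fin n → ℝ) (hu : ∀ i, 0 < u i) (hBu : ∀ i, 0 ≤ (B *ᵥ u) i) (hBu0 : B *ᵥ u ≠ 0) :
    B.PosDef := by
  have hU := aux_unit hn hZ hI u hu hBu hBu0
  have hps : B.PosSemidef := by
    refine Matrix.PosSemidef.of_dotProduct_mulVec_nonneg ?_ ?_
    · ext i j; simp [hS j i]
    · intro x
      have e1 : star x ⬝ᵥ (B *ᵥ x) = ∑ i, ∑ j, x i * (B i j * x j) := by
        simp [dotProduct, mulVec, Finset.mul_sum]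
      set z : Fin n → ℝ := fun i => x i / u i with hz
      have hxz : ∀ i, x i = u i * z i := by
        intro i; have := (hu i).ne'; simp only [hz]; field_simp
      have e2 : ∑ i, ∑ j, (B i j * u j * (u i * z i ^ 2)) = ∑ i, (B *ᵥ u) i * (u i * z i ^ 2) := by
        refine Finset.sum_congr rfl fun i _ => ?_
        rw [← Finset.sum_mul]; rfl
      have e3 : ∑ i, ∑ j, (B i j * u i * (u j * z j ^ 2)) =
          ∑ i, ∑ j, (B i j * u j * (u i * z i ^ 2)) := by
        rw [Finset.sum_comm]
        refine Finset.sum_congr rfl fun i _ => Finset.sum_congr rfl fun j _ => ?_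
        rw [hS]
      have e4 : 0 ≤ ∑ i, (B *ᵥ u) i * (u i * z i ^ 2) :=
        Finset.sum_nonneg fun i _ => mul_nonneg (hBu i) (mul_nonneg (hu i).le (sq_nonneg _))
      have e5 : ∑ i, ∑ j, (B i j * u j * (u i * z i ^ 2)) + ∑ i, ∑ j, (B i j * u i * (u j * z j ^ 2))
          ≤ 2 * ∑ i, ∑ j, x i * (B i j * x j) := by
        rw [Finset.mul_sum, ← Finset.sum_add_distrib]
        refine Finset.sum_le_sum fun i _ => ?_
        rw [Finset.mul_sum, ← Finset.sum_add_distrib]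
        refine Finset.sum_le_sum fun j _ => ?_
        rw [hxz i, hxz j]
        by_cases hij : i = j
        · subst hij; apply le_of_eq; ring
        · have h1 : (-(B i j)) * (u i * u j) * (z i - z j) ^ 2 ≥ 0 := by
            have := hZ i j hij
            have := hu i
            have := hu j
            apply mul_nonneg (mul_nonneg (by linarith) (by positivity)) (sq_nonneg _)
          nlinarith
      rw [e1]
      linarith
  exact hps.posDef_iff_isUnit.2 hU

lemma aux_pdpos {n : ℕ} {B : Matrix (Fin n) (Fin n) ℝ} (hZ : IsZmat B) (hI : IsIrred B)
    (hB : B.PosDef) (x : Fin n → ℝ) (hx : ∀ i, 0 ≤ (B *ᵥ x) i) (hx0 : B *ᵥ x ≠ 0) :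
    ∀ i, 0 < x i := by
  have hnn : ∀ i, 0 ≤ x i := by
    set m : Fin n → ℝ := fun i => max (- x i) 0 with hm
    have hm0 : m = 0 := by
      by_contra hne
      have h1 := hB.dotProduct_mulVec_pos hne
      have h2 : star m ⬝ᵥ (B *ᵥ m) ≤ - ∑ i, m i * (B *ᵥ x) i := by
        have e1 : star m ⬝ᵥ (B *ᵥ m) = ∑ i, ∑ j, m i * (B i j * m j) := by
          simp [dotProduct, mulVec, Finset.mul_sum]
        have e2 : - ∑ i, m i * (B *ᵥ x) i = ∑ i, ∑ j, - (m i * (B i j * x j)) := by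
          simp [dotProduct, mulVec, Finset.mul_sum]
        rw [e1, e2]
        refine Finset.sum_le_sum fun i _ => Finset.sum_le_sum fun j _ => ?_
        by_cases hij : i = j
        · subst hij
          have : m i * m i = m i * (- x i) := by
            simp only [hm]
            rcases max_cases (- x i) 0 with h | h <;> rw [h.1] ; simp
          apply le_of_eq
          linear_combination B i i * this
        · have h3 : 0 ≤ m i := le_max_right _ _
          have h4 : - x j ≤ m j := le_max_left _ _
          have h5 := hZ i j hij
          nlinarith [mul_nonneg (mul_nonneg h3 (neg_nonneg.2 h5)) (sub_nonneg.2 h4)]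
      have h3 : 0 ≤ ∑ i, m i * (B *ᵥ x) i :=
        Finset.sum_nonneg fun i _ => mul_nonneg (le_max_right _ _) (hx i)
      linarith
    intro i
    have := congrFun hm0 i
    simp [hm] at this
    exact this
  rcases aux_zero hZ hI x hnn (fun i _ => hx i) with h | h
  · exact absurd (by rw [h, mulVec_zero]) hx0
  · exact h

lemma aux_uniq {n : ℕ} (hn : 1 ≤ n) {B : Matrix (Fin n) (Fin n) ℝ} (hZ : IsZmat B) (hI : IsIrred B)
    (a b : Fin n → ℝ) (ra rb : ℝ) (ha : ∀ i, 0 < a i) (hb : ∀ i, 0 < b i)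
    (hsa : ∑ i, a i = 1) (hsb : ∑ i, b i = 1) (hra : B *ᵥ a = ra • a) (hrb : B *ᵥ b = rb • b) :
    a = b ∧ ra = rb := by
  have main : ∀ (a b : Fin n → ℝ) (ra rb : ℝ) (ha : ∀ i, 0 < a i) (hb : ∀ i, 0 < b i)
    (hsa : ∑ i, a i = 1) (hsb : ∑ i, b i = 1) (hra : B *ᵥ a = ra • a) (hrb : B *ᵥ b = rb • b),
    rb ≤ ra → a = b := by
    intro a b ra rb ha hb hsa hsb hra hrb hle
    obtain ⟨s, hs, i, hi⟩ := aux_min hn b a hb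
    have hs0 : 0 < s := by
      have := ha i
      rw [hi] at this
      exact pos_of_mul_pos_left this (hb i).le
    rcases aux_zero hZ hI (a - s • b) (by simpa using hs) (by
      intro j hj
      rw [mulVec_sub, mulVec_smul, hra, hrb]
      simp at hj ⊢
      have h1 : a j = s * b j := by linarith
      rw [h1]
      have := mul_nonneg (mul_pos hs0 (hb j)).le (sub_nonneg.2 hle)
      nlinarith) with h | h
    · have h2 : a = s • b := sub_eq_zero.1 h
      have : s = 1 := by
        rw [h2] at hsa
        simp [← Finset.mul_sum, hsb] at hsa
        exact hsa
      rw [h2, this, one_smul]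
    · have := h i
      simp [hi] at this
  have hab : a = b := by
    rcases le_total rb ra with h | h
    · exact main a b ra rb ha hb hsa hsb hra hrb h
    · exact (main b a rb ra hb ha hsb hsa hrb hra h).symm
  refine ⟨hab, ?_⟩
  subst hab
  have h1 := hra.symm.trans hrb
  have h2 := congrFun h1 ⟨0, hn⟩
  simp at h2
  rcases h2 with h2 | h2
  · exact h2
  · exact absurd h2 (ha _).ne'

lemma aux_perron {n : ℕ} (hn : 1 ≤ n) (M : Matrix (Fin n) (Fin n) ℝ) (hM : ∀ i j, 0 < M i j) :
    ∃ (l : Fin n → ℝ) (t : ℝ), (∀ i, 0 < l i) ∧ ∑ i, l i = 1 ∧ 0 < t ∧ M *ᵥ l = t • l := by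
  have : Nonempty (Fin n) := ⟨⟨0, hn⟩⟩
  have hMpos : ∀ y : Fin n → ℝ, (∀ i, 0 ≤ y i) → y ≠ 0 → ∀ i, 0 < (M *ᵥ y) i := by
    intro y hy hy0 i
    obtain ⟨j, hj⟩ := Function.ne_iff.1 hy0
    have : (M *ᵥ y) i = ∑ k, M i k * y k := rfl
    rw [this]
    refine Finset.sum_pos' (fun k _ => mul_nonneg (hM i k).le (hy k)) ⟨j, Finset.mem_univ _, ?_⟩
    exact mul_pos (hM i j) (lt_of_le_of_ne (hy j) (Ne.symm hj))
  set C : ℝ := ∑ i, ∑ j, M i j with hC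
  let K : Set ((Fin n → ℝ) × ℝ) :=
    (stdSimplex ℝ (Fin n) ×ˢ Icc 0 C) ∩ {p | ∀ i, p.2 * p.1 i ≤ (M *ᵥ p.1) i}
  have hcont : Continuous (fun p : (Fin n → ℝ) × ℝ => M *ᵥ p.1) :=
    Continuous.matrix_mulVec continuous_const continuous_fst
  have hKc : IsCompact K := by
    refine ((isCompact_stdSimplex ℝ (Fin n)).prod isCompact_Icc).inter_right ?_
    simp only [ofPred_forall]
    refine isClosed_iInter fun i => isClosed_le ?_ ?_
    · fun_prop
    · exact (continuous_apply i).comp hcont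
  have hCn : 0 ≤ C := Finset.sum_nonneg fun i _ => Finset.sum_nonneg fun j _ => (hM i j).le
  have hbound : ∀ y ∈ stdSimplex ℝ (Fin n), ∀ t, (∀ i, t * y i ≤ (M *ᵥ y) i) → t ≤ C := by
    intro y hy t ht
    have h1 : ∑ i, t * y i ≤ ∑ i, (M *ᵥ y) i := Finset.sum_le_sum fun i _ => ht i
    rw [← Finset.mul_sum, hy.2, mul_one] at h1
    refine h1.trans (Finset.sum_le_sum fun i _ => ?_)
    have e : (M *ᵥ y) i = ∑ k, M i k * y k := rfl
    rw [e]
    refine Finset.sum_le_sum fun j _ => ?_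
    have : y j ≤ 1 := by
      rw [← hy.2]; exact Finset.single_le_sum (fun k _ => hy.1 k) (Finset.mem_univ j)
    nlinarith [hM i j]
  have hKn : K.Nonempty := by
    refine ⟨(Pi.single ⟨0, hn⟩ 1, 0), ⟨single_mem_stdSimplex ℝ _, ⟨le_rfl, hCn⟩⟩, ?_⟩
    intro i
    simp
    exact (hM i _).le
  obtain ⟨⟨y, t⟩, ⟨⟨hy, ht⟩, hyt⟩, hmax⟩ := hKc.exists_isMaxOn hKn (continuous_snd.continuousOn)
  simp only [mem_ofPred_eq] at hyt hy ht
  have hy0 : y ≠ 0 := by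
    rintro rfl
    have := hy.2
    simp at this
  have hMy := hMpos y hy.1 hy0
  have heq : M *ᵥ y = t • y := by
    by_contra hne
    have hd : ∀ i, 0 < (M *ᵥ (M *ᵥ y - t • y)) i :=
      hMpos _ (fun i => by simpa using hyt i) (sub_ne_zero.2 hne)
    set z := M *ᵥ y with hz
    have hd' : ∀ i, t * z i < (M *ᵥ z) i := by
      intro i
      have := hd i
      rw [mulVec_sub, mulVec_smul] at this
      simpa [← hz] using this
    obtain ⟨i, hi⟩ := Finite.exists_min (fun i => (M *ᵥ z) i / z i)
    set t' := (M *ᵥ z) i / z i with ht'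
    have htt : t < t' := (lt_div_iff₀ (hMy i)).2 (hd' i)
    set S := ∑ i, z i with hS
    have hSpos : 0 < S := Finset.sum_pos (fun i _ => hMy i) Finset.univ_nonempty
    have hw : S⁻¹ • z ∈ stdSimplex ℝ (Fin n) := by
      refine ⟨fun i => ?_, ?_⟩
      · simpa using mul_nonneg (inv_pos.2 hSpos).le (hMy i).le
      · simp [← Finset.mul_sum]
        exact inv_mul_cancel₀ hSpos.ne'
    have hw2 : ∀ i, t' * (S⁻¹ • z) i ≤ (M *ᵥ (S⁻¹ • z)) i := by
      intro j
      rw [mulVec_smul]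
      simp
      have := (le_div_iff₀ (hMy j)).1 (hi j)
      have := mul_le_mul_of_nonneg_left this (inv_pos.2 hSpos).le
      linarith
    have := hmax (⟨⟨hw, ⟨ht.1.trans htt.le, hbound _ hw _ hw2⟩⟩, hw2⟩ : (S⁻¹ • z, t') ∈ K)
    simp at this
    linarith
  have hty : ∀ i, 0 < t * y i := by
    intro i
    have := hMy i
    rw [heq] at this
    simpa using this
  have htpos : 0 < t := lt_of_le_of_ne ht.1 (by
    rintro h
    have := hty ⟨0, hn⟩
    simp [← h] at this)
  exact ⟨y, t, fun i => pos_of_mul_pos_right (hty i) htpos.le, hy.2, htpos, heq⟩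

def Bm {k : ℕ} (Y : Matrix (Fin k) (Fin k) ℝ) (Vs : Fin k → ℝ) (x : Fin k → ℝ) :
    Matrix (Fin k) (Fin k) ℝ :=
  Y * Matrix.diagonal x - Matrix.diagonal (Y *ᵥ (Vs - x))

def PP {k : ℕ} (Y : Matrix (Fin k) (Fin k) ℝ) (Vs x l : Fin k → ℝ) (r : ℝ) : Prop :=
  (∀ i, 0 < x i) ∧ (∀ i, 0 < l i) ∧ ∑ i, l i = 1 ∧ Bm Y Vs x *ᵥ l = r • l

def rho {k : ℕ} (Y : Matrix (Fin k) (Fin k) ℝ) (Vs x l : Fin k → ℝ) : ℝ :=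
  ∑ i, (Bm Y Vs x *ᵥ l) i

def QQ {k : ℕ} (Y : Matrix (Fin k) (Fin k) ℝ) (Vs x l : Fin k → ℝ) : Prop :=
  (∀ i, 0 ≤ x i) ∧ (∀ i, 0 ≤ Bm Y Vs x i i) ∧ Bm Y Vs x *ᵥ l = rho Y Vs x l • l ∧
    0 ≤ rho Y Vs x l

lemma irr_of {n : ℕ} {Y B : Matrix (Fin n) (Fin n) ℝ} (hI : IsIrred Y)
    (h : ∀ i j, i ≠ j → Y i j ≠ 0 → B i j ≠ 0) : IsIrred B := by
  intro α h1 h2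
  obtain ⟨i, hi, j, hj, hij⟩ := hI α h1 h2
  refine ⟨i, hi, j, hj, h i j ?_ hij⟩
  rintro rfl
  simp at hj
  exact hj hi

lemma Bm_off {n : ℕ} (Y : Matrix (Fin n) (Fin n) ℝ) (Vs x : Fin n → ℝ) (i j : Fin n) (h : i ≠ j) :
    Bm Y Vs x i j = Y i j * x j := by
  simp [Bm, mul_diagonal, h]

lemma Bm_Z {n : ℕ} {Y : Matrix (Fin n) (Fin n) ℝ} (hZ : IsZmat Y) (Vs x : Fin n → ℝ)
    (hx : ∀ i, 0 ≤ x i) : IsZmat (Bm Y Vs x) := by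
  intro i j h
  rw [Bm_off _ _ _ _ _ h]
  exact mul_nonpos_of_nonpos_of_nonneg (hZ i j h) (hx j)

lemma Bm_I {n : ℕ} {Y : Matrix (Fin n) (Fin n) ℝ} (hI : IsIrred Y) (Vs x : Fin n → ℝ)
    (hx : ∀ i, 0 < x i) : IsIrred (Bm Y Vs x) :=
  irr_of hI fun i j h hY => by
    rw [Bm_off _ _ _ _ _ h]
    exact mul_ne_zero hY (hx j).ne'

lemma hmat_apply {n : ℕ} (Y : Matrix (Fin n) (Fin n) ℝ) (l : Fin n → ℝ) (i j : Fin n) :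
    hmat Y l i j = (l i + l j) / 2 * Y i j := by
  simp [hmat, mul_diagonal, diagonal_mul]
  ring

lemma hmat_Z {n : ℕ} {Y : Matrix (Fin n) (Fin n) ℝ} (hZ : IsZmat Y) (l : Fin n → ℝ)
    (hl : ∀ i, 0 < l i) : IsZmat (hmat Y l) := by
  intro i j h
  rw [hmat_apply]
  exact mul_nonpos_of_nonneg_of_nonpos (by linarith [hl i, hl j]) (hZ i j h)

lemma hmat_I {n : ℕ} {Y : Matrix (Fin n) (Fin n) ℝ} (hI : IsIrred Y) (l : Fin n → ℝ)
    (hl : ∀ i, 0 < l i) : IsIrred (hmat Y l) :=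
  irr_of hI fun i j h hY => by
    rw [hmat_apply]
    exact mul_ne_zero (by linarith [hl i, hl j]) hY

lemma Bm_key {n : ℕ} (Y : Matrix (Fin n) (Fin n) ℝ) (Vs x l : Fin n → ℝ) (i : Fin n) :
    (Bm Y Vs x *ᵥ l) i = 2 * (hmat Y l *ᵥ x) i - l i * (Y *ᵥ Vs) i := by
  have e1 : (hmat Y l *ᵥ x) i = ∑ j, (l i + l j) / 2 * Y i j * x j := by
    simp [mulVec, dotProduct, hmat_apply]
  have e2 : (Bm Y Vs x *ᵥ l) i = (∑ j, Y i j * x j * l j) - (Y *ᵥ (Vs - x)) i * l i := by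
    rw [Bm, sub_mulVec]
    simp [mulVec_diagonal]
    simp [mulVec, dotProduct, mul_diagonal]
  have e3 : (Y *ᵥ x) i = ∑ j, Y i j * x j := rfl
  rw [e2, e1, mulVec_sub, Pi.sub_apply, e3, Finset.mul_sum, sub_mul, Finset.sum_mul]
  have : ∑ j, 2 * ((l i + l j) / 2 * Y i j * x j) =
      ∑ j, Y i j * x j * l j + ∑ j, Y i j * x j * l i := by
    rw [← Finset.sum_add_distrib]
    exact Finset.sum_congr rfl fun j _ => by ring
  rw [this]
  ring

lemma PhiD_iff {n : ℕ} (Y : Matrix (Fin n) (Fin n) ℝ) (Vs x l : Fin n → ℝ) (r : ℝ)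
    (h : (hmat Y l).PosDef) : x = PhiD Y Vs l r ↔ Bm Y Vs x *ᵥ l = r • l := by
  have hU := (Matrix.isUnit_iff_isUnit_det _).1 h.isUnit
  set b : Fin n → ℝ := Matrix.diagonal l *ᵥ (Y *ᵥ Vs + r • (1 : Fin n → ℝ)) with hb
  have hbi : ∀ i, b i = l i * ((Y *ᵥ Vs) i + r) := by
    intro i; simp [hb, mulVec_diagonal]
  have h1 : x = PhiD Y Vs l r ↔ hmat Y l *ᵥ x = (1/2 : ℝ) • b := by
    unfold PhiD
    rw [← hb]
    constructor
    · rintro rfl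
      rw [mulVec_smul, mulVec_mulVec, Matrix.mul_nonsing_inv _ hU, one_mulVec]
    · intro hx
      rw [← mulVec_smul, ← hx, mulVec_mulVec, Matrix.nonsing_inv_mul _ hU, one_mulVec]
  rw [h1, funext_iff, funext_iff]
  refine forall_congr' fun i => ?_
  rw [Bm_key]
  simp [hbi]
  constructor <;> intro h <;> linarith

section
variable {n : ℕ} {Y : Matrix (Fin n) (Fin n) ℝ} {Vs : Fin n → ℝ}

lemma K1 (hZ : IsZmat Y) (hirr : IsIrred Y)
    (hInn : ∀ i, 0 ≤ (Y *ᵥ Vs) i) (hIne : Y *ᵥ Vs ≠ 0) (l : Fin n → ℝ) (hl : l ∈ Lam1 Y)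
    (r : ℝ) (hr : 0 ≤ r) : PP Y Vs (PhiD Y Vs l r) l r := by
  have hk := (PhiD_iff Y Vs _ l r hl.1).1 rfl
  have hh : ∀ i, (hmat Y l *ᵥ PhiD Y Vs l r) i = l i * ((Y *ᵥ Vs) i + r) / 2 := by
    intro i
    have h1 := congrFun hk i
    rw [Bm_key] at h1
    simp at h1
    linarith
  refine ⟨?_, hl.2.1, hl.2.2, hk⟩
  refine aux_pdpos (hmat_Z hZ l hl.2.1) (hmat_I hirr l hl.2.1) hl.1 _ ?_ ?_
  · intro i
    rw [hh]
    have := mul_nonneg (hl.2.1 i).le (add_nonneg (hInn i) hr)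
    linarith
  · obtain ⟨i, hi⟩ := Function.ne_iff.1 hIne
    intro h0
    have h1 := hh i
    rw [h0] at h1
    have hp : 0 < (Y *ᵥ Vs) i := lt_of_le_of_ne (hInn i) (Ne.symm hi)
    have := mul_pos (hl.2.1 i) (add_pos_of_pos_of_nonneg hp hr)
    rw [Pi.zero_apply] at h1
    linarith

lemma K2 (hn : 1 ≤ n) (hS : ∀ i j, Y i j = Y j i) (hZ : IsZmat Y) (hirr : IsIrred Y)
    (hInn : ∀ i, 0 ≤ (Y *ᵥ Vs) i) (hIne : Y *ᵥ Vs ≠ 0) (x l : Fin n → ℝ)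
    (r : ℝ) (hr : 0 ≤ r) (h : PP Y Vs x l r) : l ∈ Lam1 Y ∧ x = PhiD Y Vs l r := by
  obtain ⟨hx, hl, hs, hB⟩ := h
  have hh : ∀ i, (hmat Y l *ᵥ x) i = l i * ((Y *ᵥ Vs) i + r) / 2 := by
    intro i
    have h1 := congrFun hB i
    rw [Bm_key] at h1
    simp at h1
    linarith
  have hpd : (hmat Y l).PosDef := by
    refine aux_pd hn (hmat_Z hZ l hl) (hmat_I hirr l hl) ?_ x hx ?_ ?_
    · intro i j; rw [hmat_apply, hmat_apply, hS i j]; ring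
    · intro i
      rw [hh]
      have := mul_nonneg (hl i).le (add_nonneg (hInn i) hr)
      linarith
    · obtain ⟨i, hi⟩ := Function.ne_iff.1 hIne
      intro h0
      have h1 := hh i
      rw [h0] at h1
      have hp : 0 < (Y *ᵥ Vs) i := lt_of_le_of_ne (hInn i) (Ne.symm hi)
      have := mul_pos (hl i) (add_pos_of_pos_of_nonneg hp hr)
      rw [Pi.zero_apply] at h1
      linarith
  exact ⟨⟨hpd, hl, hs⟩, (PhiD_iff Y Vs x l r hpd).2 hB⟩

lemma J_eq (hS : ∀ i j, Y i j = Y j i) (x : Fin n → ℝ) : Jmat Y Vs x = -(Bm Y Vs x)ᵀ := by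
  have hYt : Yᵀ = Y := by ext i j; simp [hS j i]
  simp [Jmat, Bm, transpose_mul, hYt]

lemma K3' (hn : 1 ≤ n) (hS : ∀ i j, Y i j = Y j i) (hZ : IsZmat Y) (hirr : IsIrred Y)
    (x l : Fin n → ℝ) (hx : ∀ i, 0 < x i) (hl : ∀ i, 0 < l i)
    (hB : ∀ i, 0 < (Bm Y Vs x *ᵥ l) i) : x ∈ Dset Y Vs := by
  have h0 : Bm Y Vs x *ᵥ l ≠ 0 := by
    intro h
    have := hB ⟨0, hn⟩
    simp [h] at this
  have hZ' := Bm_Z hZ Vs x (fun i => (hx i).le)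
  have hI' := Bm_I hirr Vs x hx
  have hU := (Matrix.isUnit_iff_isUnit_det _).1
    (aux_unit hn hZ' hI' l hl (fun i => (hB i).le) h0)
  have hi := aux_inv hn hZ' hI' l hl (fun i => (hB i).le) h0
  have hJ : Jmat Y Vs x * (-((Bm Y Vs x)⁻¹)ᵀ) = 1 := by
    rw [J_eq hS, neg_mul_neg, ← transpose_mul, Matrix.nonsing_inv_mul _ hU, transpose_one]
  refine ⟨hx, (Matrix.isUnit_iff_isUnit_det _).1 (IsUnit.of_mul_eq_one _ hJ), ?_⟩
  intro i j
  rw [Matrix.inv_eq_right_inv hJ]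
  simpa using hi j i

lemma K3 (hn : 1 ≤ n) (hS : ∀ i j, Y i j = Y j i) (hZ : IsZmat Y) (hirr : IsIrred Y)
    (x l : Fin n → ℝ) (r : ℝ) (hr : 0 < r) (h : PP Y Vs x l r) : x ∈ Dset Y Vs := by
  refine K3' hn hS hZ hirr x l h.1 h.2.1 fun i => ?_
  rw [h.2.2.2]
  simpa using mul_pos hr (h.2.1 i)

lemma K4 (hn : 1 ≤ n) (hS : ∀ i j, Y i j = Y j i)
    (x : Fin n → ℝ) (hx : x ∈ Dset Y Vs) : ∃ l r, 0 < r ∧ PP Y Vs x l r := by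
  obtain ⟨hx0, hU, hneg⟩ := hx
  set J := Jmat Y Vs x with hJ
  obtain ⟨l, t, hl, hs, ht, he⟩ := aux_perron hn (-(J⁻¹)ᵀ) (by
    intro i j; simpa using hneg j i)
  refine ⟨l, t⁻¹, inv_pos.2 ht, hx0, hl, hs, ?_⟩
  have hB : Bm Y Vs x = - Jᵀ := by rw [hJ, J_eq hS]; simp
  have h1 : Bm Y Vs x *ᵥ (-(J⁻¹)ᵀ *ᵥ l) = l := by
    rw [hB, mulVec_mulVec, neg_mul_neg, ← transpose_mul, Matrix.nonsing_inv_mul _ hU,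
      transpose_one, one_mulVec]
  rw [he, mulVec_smul] at h1
  have h2 := congrArg (fun v => t⁻¹ • v) h1
  simpa [smul_smul, inv_mul_cancel₀ ht.ne'] using h2

lemma K5 (hn : 1 ≤ n) (hZ : IsZmat Y) (hirr : IsIrred Y)
    (x a b : Fin n → ℝ) (ra rb : ℝ) (h : PP Y Vs x a ra) (h' : PP Y Vs x b rb) :
    a = b ∧ ra = rb :=
  aux_uniq hn (Bm_Z hZ Vs x fun i => (h.1 i).le) (Bm_I hirr Vs x h.1) a b ra rb h.2.1 h'.2.1
    h.2.2.1 h'.2.2.1 h.2.2.2 h'.2.2.2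

lemma PP_rho {x l : Fin n → ℝ} {r : ℝ} (h : PP Y Vs x l r) : rho Y Vs x l = r := by
  unfold rho
  rw [h.2.2.2]
  simp [← Finset.mul_sum, h.2.2.1]

lemma PP_QQ (hZ : IsZmat Y) {x l : Fin n → ℝ} {r : ℝ} (hr : 0 ≤ r) (h : PP Y Vs x l r) :
    QQ Y Vs x l := by
  have h1 := PP_rho h
  refine ⟨fun i => (h.1 i).le, ?_, by rw [h1]; exact h.2.2.2, by rw [h1]; exact hr⟩
  intro i
  by_contra hc
  push Not at hc
  have h2 : (Bm Y Vs x *ᵥ l) i < 0 := by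
    have e : (Bm Y Vs x *ᵥ l) i = ∑ k, Bm Y Vs x i k * l k := rfl
    rw [e]
    refine Finset.sum_neg' (fun k _ => ?_) ⟨i, Finset.mem_univ _, mul_neg_of_neg_of_pos hc (h.2.1 i)⟩
    by_cases hk : i = k
    · subst hk; exact (mul_neg_of_neg_of_pos hc (h.2.1 i)).le
    · exact mul_nonpos_of_nonpos_of_nonneg (Bm_Z hZ Vs x (fun i => (h.1 i).le) i k hk) (h.2.1 k).le
  rw [h.2.2.2] at h2
  have := mul_nonneg hr (h.2.1 i).le
  simp at h2
  linarith

lemma QQ_PP (hn : 1 ≤ n) (hZ : IsZmat Y) (hirr : IsIrred Y)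
    (hInn : ∀ i, 0 ≤ (Y *ᵥ Vs) i) (hIne : Y *ᵥ Vs ≠ 0)
    {x l : Fin n → ℝ} (hl : l ∈ stdSimplex ℝ (Fin n)) (h : QQ Y Vs x l) :
    PP Y Vs x l (rho Y Vs x l) := by
  obtain ⟨hx, hd, hB, hr⟩ := h
  have hdiag : ∀ i, Bm Y Vs x i i = Y i i * x i - ((Y *ᵥ Vs) i - (Y *ᵥ x) i) := by
    intro i
    simp [Bm, mul_diagonal, mulVec_sub]
  have hxpos : ∀ i, 0 < x i := by
    rcases aux_zero hZ hirr x hx (by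
      intro i hi
      have h1 := hd i
      rw [hdiag, hi] at h1
      linarith [hInn i]) with h | h
    · exfalso
      apply hIne
      funext i
      have h1 := hd i
      rw [hdiag, h] at h1
      simp at h1
      exact le_antisymm h1 (hInn i)
    · exact h
  have hlpos : ∀ i, 0 < l i := by
    rcases aux_zero (Bm_Z hZ Vs x hx) (Bm_I hirr Vs x hxpos) l hl.1 (by
      intro i hi
      rw [hB]
      simp [hi]) with h | h
    · exfalso
      have := hl.2
      simp [h] at this
    · exact h
  exact ⟨hxpos, hlpos, hl.2, hB⟩

lemma cont_Bm : Continuous (fun x : Fin n → ℝ => Bm Y Vs x) := by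
  unfold Bm
  refine Continuous.sub (continuous_const.matrix_mul (Continuous.matrix_diagonal continuous_id)) ?_
  refine Continuous.matrix_diagonal ?_
  exact Continuous.matrix_mulVec continuous_const (continuous_const.sub continuous_id)

lemma cont_Bml : Continuous (fun p : (Fin n → ℝ) × (Fin n → ℝ) => Bm Y Vs p.1 *ᵥ p.2) :=
  Continuous.matrix_mulVec (cont_Bm.comp continuous_fst) continuous_snd

lemma cont_rho : Continuous (fun p : (Fin n → ℝ) × (Fin n → ℝ) => rho Y Vs p.1 p.2) := by
  unfold rho
  exact continuous_finsetSum _ fun i _ => (continuous_apply i).comp cont_Bml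

lemma closed_QQ : IsClosed {p : (Fin n → ℝ) × (Fin n → ℝ) | QQ Y Vs p.1 p.2} := by
  unfold QQ
  refine IsClosed.and ?_ (IsClosed.and ?_ (IsClosed.and ?_ ?_))
  · simp only [ofPred_forall]
    exact isClosed_iInter fun i => isClosed_le continuous_const (by fun_prop)
  · simp only [ofPred_forall]
    refine isClosed_iInter fun i => isClosed_le continuous_const ?_
    exact ((continuous_apply_apply i i).comp cont_Bm).comp continuous_fst
  · exact isClosed_eq cont_Bml (cont_rho.smul continuous_snd)
  · exact isClosed_le continuous_const cont_rho

lemma cont_PhiD : ContinuousOn (fun p : (Fin n → ℝ) × ℝ => PhiD Y Vs p.1 p.2)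
    (Lam1 Y ×ˢ Ici (0 : ℝ)) := by
  have hc : Continuous (fun p : (Fin n → ℝ) × ℝ => hmat Y p.1) := by
    unfold hmat
    have hd : Continuous (fun p : (Fin n → ℝ) × ℝ => Matrix.diagonal p.1) :=
      Continuous.matrix_diagonal continuous_fst
    exact ((hd.matrix_mul continuous_const).add (continuous_const.matrix_mul hd)).const_smul (1/2 : ℝ)
  have hb : Continuous (fun p : (Fin n → ℝ) × ℝ =>
      Matrix.diagonal p.1 *ᵥ (Y *ᵥ Vs + p.2 • (1 : Fin n → ℝ))) :=
    Continuous.matrix_mulVec (Continuous.matrix_diagonal continuous_fst) (by fun_prop)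
  have hinv : ContinuousOn (fun p : (Fin n → ℝ) × ℝ => (hmat Y p.1)⁻¹) (Lam1 Y ×ˢ Ici (0 : ℝ)) := by
    have : (fun p : (Fin n → ℝ) × ℝ => (hmat Y p.1)⁻¹) =
      fun p => (hmat Y p.1).det⁻¹ • (hmat Y p.1).adjugate := by
      funext p; simp [Matrix.inv_def]
    rw [this]
    refine ContinuousOn.fun_smul ?_ (Continuous.matrix_adjugate hc).continuousOn
    refine ContinuousOn.inv₀ (Continuous.matrix_det hc).continuousOn ?_
    intro p hp
    exact ((Matrix.isUnit_iff_isUnit_det _).1 hp.1.1.isUnit).ne_zero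
  unfold PhiD
  refine ContinuousOn.fun_const_smul ?_ _
  rw [continuousOn_iff_continuous_domRestrict] at hinv ⊢
  exact Continuous.matrix_mulVec hinv (hb.comp continuous_subtype_val)

lemma Lam1_convex : Convex ℝ (Lam1 Y) := by
  intro a ha b hb s t hs ht hst
  refine ⟨?_, ?_, ?_⟩
  · have e : hmat Y (s • a + t • b) = s • hmat Y a + t • hmat Y b := by
      ext i j
      simp [hmat_apply]
      ring
    rw [e]
    rcases hs.eq_or_lt with h | h
    · have : t = 1 := by linarith
      simpa [← h, this] using hb.1
    · exact (ha.1.smul h).add_posSemidef (hb.1.posSemidef.smul ht)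
  · intro i
    rcases hs.eq_or_lt with h | h
    · have : t = 1 := by linarith
      simpa [← h, this] using hb.2.1 i
    · have h1 := mul_pos h (ha.2.1 i)
      have h2 := mul_nonneg ht (hb.2.1 i).le
      simp
      linarith
  · simp [Finset.sum_add_distrib, ← Finset.mul_sum, ha.2.2, hb.2.2, hst]

lemma Lam1_nonempty (hn : 1 ≤ n) (hPD : Y.PosDef) : (Lam1 Y).Nonempty := by
  have hn' : (0 : ℝ) < n := by exact_mod_cast hn
  refine ⟨fun _ => (n : ℝ)⁻¹, ?_, ?_, ?_⟩
  · have e : hmat Y (fun _ => (n : ℝ)⁻¹) = (n : ℝ)⁻¹ • Y := by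
      ext i j
      simp [hmat_apply]
    rw [e]
    exact hPD.smul (inv_pos.2 hn')
  · intro i; exact inv_pos.2 hn'
  · simp [hn'.ne']

end

theorem stmt_8 (n : ℕ) (hn : 1 ≤ n)
    (Y : Matrix (Fin n) (Fin n) ℝ)
    (hPD : Y.PosDef)
    (hZ : IsZmat Y)
    (hirr : IsIrred Y)
    (Vs : Fin n → ℝ) (hVs : ∀ i, 0 < Vs i)
    (hInn : ∀ i, 0 ≤ (Y *ᵥ Vs) i) (hIne : Y *ᵥ Vs ≠ 0) :
    -- parametrization of D
    Dset Y Vs = {y | ∃ l ∈ Lam1 Y, ∃ r > (0 : ℝ), y = PhiD Y Vs l r} ∧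
    -- parametrization of the closure of D
    closure (Dset Y Vs) = {y | ∃ l ∈ Lam1 Y, ∃ r ≥ (0 : ℝ), y = PhiD Y Vs l r} ∧
    -- parametrization of the boundary of D
    frontier (Dset Y Vs) = phiv Y Vs '' Lam1 Y ∧
    -- (λ, r) ↦ (1/2) h(λ)⁻¹ [λ](I* + r·1) is a homeomorphism from Λ₁ × [0,∞) onto cl D
    (∃ e : (Lam1 Y ×ˢ Ici (0 : ℝ)) ≃ₜ closure (Dset Y Vs),
      ∀ p : (Lam1 Y ×ˢ Ici (0 : ℝ) : Set ((Fin n → ℝ) × ℝ)),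
        (e p : Fin n → ℝ) = PhiD Y Vs (p : (Fin n → ℝ) × ℝ).1 (p : (Fin n → ℝ) × ℝ).2) ∧
    -- simple connectedness
    SimplyConnectedSpace (Dset Y Vs) ∧
    SimplyConnectedSpace (closure (Dset Y Vs)) ∧
    SimplyConnectedSpace (frontier (Dset Y Vs)) := by
  have hS : ∀ i j, Y i j = Y j i := fun i j => by
    have := hPD.1.apply i j
    simpa using this.symm
  have k1 := K1 (Vs := Vs) hZ hirr hInn hIne
  have k2 := K2 (Vs := Vs) hn hS hZ hirr hInn hIne
  have k5 := K5 (Vs := Vs) hn hZ hirr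
  have hD : Dset Y Vs = {y | ∃ l ∈ Lam1 Y, ∃ r > (0 : ℝ), y = PhiD Y Vs l r} := by
    ext y
    constructor
    · intro hy
      obtain ⟨l, r, hr, h⟩ := K4 hn hS y hy
      obtain ⟨h1, h2⟩ := k2 y l r hr.le h
      exact ⟨l, h1, r, hr, h2⟩
    · rintro ⟨l, hl, r, hr, rfl⟩
      exact K3 hn hS hZ hirr _ l r hr (k1 l hl r (le_of_lt hr))
  set C : Set (Fin n → ℝ) := {y | ∃ l ∈ Lam1 Y, ∃ r ≥ (0 : ℝ), y = PhiD Y Vs l r} with hC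
  have hCproj : ∀ y, y ∈ C ↔ ∃ l ∈ stdSimplex ℝ (Fin n), QQ Y Vs y l := by
    intro y
    constructor
    · rintro ⟨l, hl, r, hr, rfl⟩
      exact ⟨l, ⟨fun i => (hl.2.1 i).le, hl.2.2⟩, PP_QQ hZ hr (k1 l hl r hr)⟩
    · rintro ⟨l, hl, hQ⟩
      obtain ⟨h1, h2⟩ := k2 y l _ hQ.2.2.2 (QQ_PP hn hZ hirr hInn hIne hl hQ)
      exact ⟨l, h1, _, hQ.2.2.2, h2⟩
  have : CompactSpace (stdSimplex ℝ (Fin n)) :=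
    isCompact_iff_compactSpace.1 (isCompact_stdSimplex ℝ (Fin n))
  have hCclosed : IsClosed C := by
    have e : C = Prod.fst '' {p : (Fin n → ℝ) × stdSimplex ℝ (Fin n) | QQ Y Vs p.1 p.2} := by
      ext y
      rw [hCproj]
      constructor
      · rintro ⟨l, hl, hQ⟩
        exact ⟨(y, ⟨l, hl⟩), hQ, rfl⟩
      · rintro ⟨⟨y', l⟩, hQ, rfl⟩
        exact ⟨l, l.2, hQ⟩
    rw [e]
    refine isClosedMap_fst_of_compactSpace _ ?_
    exact closed_QQ.preimage (f := fun p : (Fin n → ℝ) × stdSimplex ℝ (Fin n) =>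
      (p.1, (p.2 : Fin n → ℝ))) (by fun_prop)
  have hDC : Dset Y Vs ⊆ C := by
    rw [hD]
    rintro y ⟨l, hl, r, hr, h⟩
    exact ⟨l, hl, r, le_of_lt hr, h⟩
  have hcl : closure (Dset Y Vs) = C := by
    refine subset_antisymm (closure_minimal hDC hCclosed) ?_
    rintro y ⟨l, hl, r, hr, rfl⟩
    have hcw : ContinuousWithinAt (fun s : ℝ => PhiD Y Vs l s) (Ioi r) r := by
      have h1 := cont_PhiD (Y := Y) (Vs := Vs) (l, r) ⟨hl, hr⟩
      exact h1.comp (f := fun s : ℝ => (l, s)) (t := Lam1 Y ×ˢ Ici (0 : ℝ))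
        (by fun_prop) (fun s hs => ⟨hl, le_trans hr (le_of_lt hs)⟩)
    have h2 := hcw.mem_closure_image (by simp)
    refine closure_mono ?_ h2
    rintro _ ⟨s, hs, rfl⟩
    rw [hD]
    exact ⟨l, hl, s, lt_of_le_of_lt hr hs, rfl⟩
  have hopen : IsOpen (Dset Y Vs) := by
    rw [isOpen_iff_forall_mem_open]
    intro y hy
    obtain ⟨l, r, hr, h⟩ := K4 hn hS y hy
    refine ⟨{x | (∀ i, 0 < x i) ∧ ∀ i, 0 < (Bm Y Vs x *ᵥ l) i}, ?_, ?_, ?_⟩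
    · rintro x ⟨hx, hB⟩
      exact K3' hn hS hZ hirr x l hx h.2.1 hB
    · refine IsOpen.and ?_ ?_
      · simp only [ofPred_forall]
        exact isOpen_iInter_of_finite fun i => isOpen_lt continuous_const (by fun_prop)
      · simp only [ofPred_forall]
        refine isOpen_iInter_of_finite fun i => isOpen_lt continuous_const ?_
        exact (continuous_apply i).comp
          (Continuous.matrix_mulVec cont_Bm continuous_const)
    · refine ⟨h.1, fun i => ?_⟩
      rw [h.2.2.2]
      simpa using mul_pos hr (h.2.1 i)
  have hphi : ∀ l, phiv Y Vs l = PhiD Y Vs l 0 := by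
    intro l; simp [phiv, PhiD]
  have hfr : frontier (Dset Y Vs) = phiv Y Vs '' Lam1 Y := by
    rw [hopen.frontier_eq, hcl]
    ext y
    constructor
    · rintro ⟨⟨l, hl, r, hr, rfl⟩, hnot⟩
      rcases (show (0 : ℝ) ≤ r from hr).eq_or_lt with h | h
      · subst h
        exact ⟨l, hl, hphi l⟩
      · exact absurd (hD ▸ ⟨l, hl, r, h, rfl⟩) hnot
    · rintro ⟨l, hl, rfl⟩
      rw [hphi]
      refine ⟨⟨l, hl, 0, le_rfl, rfl⟩, fun hmem => ?_⟩
      obtain ⟨l', r', hr', h'⟩ := K4 hn hS _ hmem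
      have := (k5 _ _ _ _ _ (k1 l hl 0 le_rfl) h').2
      linarith
  have hex : ∃ e : (Lam1 Y ×ˢ Ici (0 : ℝ) : Set ((Fin n → ℝ) × ℝ)) ≃ₜ C,
      ∀ p : (Lam1 Y ×ˢ Ici (0 : ℝ) : Set ((Fin n → ℝ) × ℝ)),
        (e p : Fin n → ℝ) = PhiD Y Vs (p : (Fin n → ℝ) × ℝ).1 (p : (Fin n → ℝ) × ℝ).2 := by
    choose g hg hgQ using fun y : C => (hCproj y).1 y.2
    have hgPP : ∀ y : C, PP Y Vs y (g y) (rho Y Vs y (g y)) := fun y =>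
      QQ_PP hn hZ hirr hInn hIne (hg y) (hgQ y)
    let g' : C → stdSimplex ℝ (Fin n) := fun y => ⟨g y, hg y⟩
    have hg'c : Continuous g' := by
      rw [continuous_iff_isClosed]
      intro s hs
      have e : g' ⁻¹' s = Prod.fst ''
          ({p : C × stdSimplex ℝ (Fin n) | QQ Y Vs p.1 p.2} ∩ Prod.snd ⁻¹' s) := by
        ext y
        constructor
        · intro hy
          exact ⟨(y, g' y), ⟨hgQ y, hy⟩, rfl⟩
        · rintro ⟨⟨y', l⟩, ⟨hQ, hl⟩, rfl⟩
          have h1 := QQ_PP hn hZ hirr hInn hIne l.2 hQ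
          have h2 := (k5 _ _ _ _ _ (hgPP y') h1).1
          have h3 : g' y' = l := Subtype.ext h2
          simp only [mem_preimage] at hl ⊢
          rw [h3]; exact hl
      rw [e]
      refine isClosedMap_fst_of_compactSpace _ (IsClosed.inter ?_ (hs.preimage continuous_snd))
      exact closed_QQ.preimage (f := fun p : C × stdSimplex ℝ (Fin n) =>
        ((p.1 : Fin n → ℝ), (p.2 : Fin n → ℝ))) (by fun_prop)
    have hgc : Continuous g := continuous_subtype_val.comp hg'c
    have hrc : Continuous (fun y : C => rho Y Vs y (g y)) :=
      (cont_rho (Y := Y) (Vs := Vs)).comp (f := fun y : C => ((y : Fin n → ℝ), g y))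
        (continuous_subtype_val.prodMk hgc)
    refine ⟨⟨⟨fun p => ⟨PhiD Y Vs p.1.1 p.1.2, p.1.1, p.2.1, p.1.2, p.2.2, rfl⟩,
      fun y => ⟨(g y, rho Y Vs y (g y)), (k2 _ _ _ (hgQ y).2.2.2 (hgPP y)).1, (hgQ y).2.2.2⟩,
      ?_, ?_⟩, ?_, ?_⟩, fun p => rfl⟩
    · rintro ⟨⟨l, r⟩, hl, hr⟩
      have h1 := k1 l hl r hr
      obtain ⟨h2, h3⟩ := k5 _ _ _ _ _ (hgPP ⟨PhiD Y Vs l r, l, hl, r, hr, rfl⟩) h1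
      exact Subtype.ext (Prod.ext h2 h3)
    · intro y
      exact Subtype.ext (k2 _ _ _ (hgQ y).2.2.2 (hgPP y)).2.symm
    · exact Continuous.subtype_mk (continuousOn_iff_continuous_domRestrict.1 cont_PhiD) _
    · exact Continuous.subtype_mk (hgc.prodMk hrc) _
  obtain ⟨e, he⟩ := hex
  have hsc : ∀ (R : Set ℝ) (T : Set (Fin n → ℝ)), R ⊆ Ici 0 → Convex ℝ R → R.Nonempty →
      T = {y | ∃ l ∈ Lam1 Y, ∃ r ∈ R, y = PhiD Y Vs l r} → SimplyConnectedSpace T := by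
    intro R T hR hRc hRn hT
    have hsub : Lam1 Y ×ˢ R ⊆ Lam1 Y ×ˢ Ici (0 : ℝ) := prod_mono subset_rfl hR
    have hemb : Topology.IsEmbedding (fun p : (Lam1 Y ×ˢ R : Set ((Fin n → ℝ) × ℝ)) =>
        ((e (inclusion hsub p) : C) : Fin n → ℝ)) :=
      Topology.IsEmbedding.subtypeVal.comp
        (e.isEmbedding.comp (Topology.IsEmbedding.inclusion hsub))
    have hrange : range (fun p : (Lam1 Y ×ˢ R : Set ((Fin n → ℝ) × ℝ)) =>
        ((e (inclusion hsub p) : C) : Fin n → ℝ)) = T := by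
      rw [hT]
      ext y
      constructor
      · rintro ⟨⟨⟨l, r⟩, hl, hr⟩, rfl⟩
        exact ⟨l, hl, r, hr, he _⟩
      · rintro ⟨l, hl, r, hr, rfl⟩
        exact ⟨⟨(l, r), hl, hr⟩, he _⟩
    have hcs : ContractibleSpace (Lam1 Y ×ˢ R : Set ((Fin n → ℝ) × ℝ)) :=
      (Lam1_convex.prod hRc).contractibleSpace ((Lam1_nonempty hn hPD).prod hRn)
    have := hemb.toHomeomorph.symm.contractibleSpace
    rw [hrange] at this
    exact SimplyConnectedSpace.ofContractible _
  refine ⟨hD, hcl, hfr, ?_, ?_, ?_, ?_⟩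
  · rw [hcl]
    exact ⟨e, he⟩
  · exact hsc (Ioi 0) _ Ioi_subset_Ici_self (convex_Ioi 0) ⟨1, by simp⟩ hD
  · exact hsc (Ici 0) _ subset_rfl (convex_Ici 0) ⟨1, by simp⟩ hcl
  · refine hsc {0} _ (by simp) (convex_singleton 0) ⟨0, rfl⟩ ?_
    rw [hfr]
    ext y
    constructor
    · rintro ⟨l, hl, rfl⟩
      exact ⟨l, hl, 0, rfl, hphi l⟩
    · rintro ⟨l, hl, r, rfl, rfl⟩
      exact ⟨l, hl, hphi l⟩
end
end

section
/- The map λ ↦ P_c(φ(λ)) is injective on Λ₁ and its image equals the topological boundary of the convex hull of F; moreover, the convex hull of F is a closed set. -/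
open Matrix Set

noncomputable section

section helpers

variable {n : ℕ}

lemma aux_pc (Y : Matrix (Fin n) (Fin n) ℝ) (Vs x : Fin n → ℝ) (i : Fin n) :
    Pc Y Vs x i = x i * ((Y *ᵥ Vs) i - (Y *ᵥ x) i) := by
  simp [Pc, mulVec_diagonal, mulVec_sub]

lemma aux_h (Y : Matrix (Fin n) (Fin n) ℝ) (l : Fin n → ℝ) (i j : Fin n) :
    hmat Y l i j = (l i + l j) / 2 * Y i j := by
  simp [hmat, diagonal_mul, mul_diagonal]; ring

lemma aux_sym {A : Matrix (Fin n) (Fin n) ℝ} (hA : A.PosDef) (i j : Fin n) : A i j = A j i := by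
  have := hA.isHermitian.apply i j
  simpa using this.symm

lemma aux_dot_sym {A : Matrix (Fin n) (Fin n) ℝ} (hA : ∀ i j, A i j = A j i) (x y : Fin n → ℝ) :
    x ⬝ᵥ (A *ᵥ y) = y ⬝ᵥ (A *ᵥ x) := by
  simp only [dotProduct, mulVec, Finset.mul_sum]
  rw [Finset.sum_comm]
  refine Finset.sum_congr rfl fun i _ => Finset.sum_congr rfl fun j _ => ?_
  rw [hA j i]; ring

lemma aux_hsym {Y : Matrix (Fin n) (Fin n) ℝ} (hY : ∀ i j, Y i j = Y j i) (l : Fin n → ℝ)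
    (i j : Fin n) : hmat Y l i j = hmat Y l j i := by
  rw [aux_h, aux_h, hY i j]; ring

lemma aux_hmul (Y : Matrix (Fin n) (Fin n) ℝ) (l x : Fin n → ℝ) (i : Fin n) :
    (hmat Y l *ᵥ x) i = (l i * (Y *ᵥ x) i + (Y *ᵥ (fun j => l j * x j)) i) / 2 := by
  simp only [mulVec, dotProduct, aux_h, Finset.mul_sum, ← Finset.sum_add_distrib, Finset.sum_div]
  refine Finset.sum_congr rfl fun j _ => ?_
  ring

lemma aux_q {Y : Matrix (Fin n) (Fin n) ℝ} (hY : ∀ i j, Y i j = Y j i) (l x : Fin n → ℝ) :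
    x ⬝ᵥ (hmat Y l *ᵥ x) = ∑ i, l i * x i * (Y *ᵥ x) i := by
  have h1 := aux_dot_sym hY x (fun j => l j * x j)
  simp only [dotProduct] at h1 ⊢
  simp only [aux_hmul]
  have : ∀ i, x i * ((l i * (Y *ᵥ x) i + (Y *ᵥ (fun j => l j * x j)) i) / 2) =
    (l i * x i * (Y *ᵥ x) i) / 2 + (x i * (Y *ᵥ (fun j => l j * x j)) i) / 2 := by
    intro i; ring
  simp only [this, Finset.sum_add_distrib, ← Finset.sum_div, h1]
  ring

lemma aux_lp {Y : Matrix (Fin n) (Fin n) ℝ} (hY : ∀ i j, Y i j = Y j i) (Vs l x : Fin n → ℝ) :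
    l ⬝ᵥ Pc Y Vs x = ∑ i, l i * x i * (Y *ᵥ Vs) i - x ⬝ᵥ (hmat Y l *ᵥ x) := by
  rw [aux_q hY, ← Finset.sum_sub_distrib]
  simp only [dotProduct, aux_pc]
  refine Finset.sum_congr rfl fun j _ => ?_
  ring

/-- irreducible Z-matrices: nonnegative vectors with a sign condition are zero or positive -/
lemma aux_Z {A : Matrix (Fin n) (Fin n) ℝ} (hZ : IsZmat A) (hi : IsIrred A) (w : Fin n → ℝ)
    (hw : ∀ i, 0 ≤ w i) (hA : ∀ i, w i = 0 → 0 ≤ (A *ᵥ w) i) (h0 : w ≠ 0) : ∀ i, 0 < w i := by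
  by_contra hcon
  push Not at hcon
  obtain ⟨k, hk⟩ := hcon
  have hk0 : w k = 0 := le_antisymm hk (hw k)
  obtain ⟨m, hm⟩ : ∃ m, w m ≠ 0 := by
    by_contra h; push Not at h; exact h0 (funext h)
  obtain ⟨i, hi1, j, hj, hij⟩ := hi (Finset.univ.filter fun i => w i = 0) ⟨k, by simp [hk0]⟩
    (by intro h; have := Finset.mem_univ m; rw [← h] at this; simp at this; exact hm this)
  simp at hi1 hj
  have h1 := hA i hi1
  have h2 : (A *ᵥ w) i < 0 := by
    simp only [mulVec, dotProduct]
    refine Finset.sum_neg' ?_ ⟨j, Finset.mem_univ _, ?_⟩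
    · intro s _
      by_cases hs : i = s
      · subst hs; simp [hi1]
      · exact mul_nonpos_of_nonpos_of_nonneg (hZ i s hs) (hw s)
    · have hne : i ≠ j := by rintro rfl; exact hj hi1
      exact mul_neg_of_neg_of_pos (lt_of_le_of_ne (hZ i j hne) hij)
        (lt_of_le_of_ne (hw j) (Ne.symm hj))
  linarith

lemma aux_hZ {Y : Matrix (Fin n) (Fin n) ℝ} (hZ : IsZmat Y) {l : Fin n → ℝ} (hl : ∀ i, 0 < l i) :
    IsZmat (hmat Y l) := by
  intro i j hij
  rw [aux_h]
  have := hl i; have := hl j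
  exact mul_nonpos_of_nonneg_of_nonpos (by linarith) (hZ i j hij)

lemma aux_hirr {Y : Matrix (Fin n) (Fin n) ℝ} (hZ : IsIrred Y) {l : Fin n → ℝ}
    (hl : ∀ i, 0 < l i) : IsIrred (hmat Y l) := by
  intro a h1 h2
  obtain ⟨i, hi, j, hj, hij⟩ := hZ a h1 h2
  refine ⟨i, hi, j, hj, ?_⟩
  rw [aux_h]
  have := hl i; have := hl j
  exact mul_ne_zero (by linarith) hij

lemma aux_abs {A : Matrix (Fin n) (Fin n) ℝ} (hZ : IsZmat A) (x : Fin n → ℝ) :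
    (fun i => |x i|) ⬝ᵥ (A *ᵥ (fun i => |x i|)) ≤ x ⬝ᵥ (A *ᵥ x) := by
  simp only [dotProduct, mulVec, Finset.mul_sum]
  refine Finset.sum_le_sum fun i _ => Finset.sum_le_sum fun j _ => ?_
  by_cases h : i = j
  · subst h
    have := abs_mul_abs_self (x i)
    exact le_of_eq (by linear_combination (A i i) * this)
  · have h1 := hZ i j h
    have h2 : x i * x j ≤ |x i| * |x j| := by rw [← abs_mul]; exact le_abs_self _
    nlinarith

lemma aux_phi {Y : Matrix (Fin n) (Fin n) ℝ} (Vs : Fin n → ℝ) {l : Fin n → ℝ}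
    (hl : (hmat Y l).PosDef) (i : Fin n) :
    (hmat Y l *ᵥ phiv Y Vs l) i = l i * (Y *ᵥ Vs) i / 2 := by
  have hu : IsUnit (hmat Y l).det := (Matrix.isUnit_iff_isUnit_det _).1 hl.isUnit
  rw [phiv, mulVec_smul, mulVec_mulVec, Matrix.mul_nonsing_inv _ hu, one_mulVec]
  rw [Pi.smul_apply, mulVec_diagonal, smul_eq_mul]; ring

lemma aux_exp {Y : Matrix (Fin n) (Fin n) ℝ} (hY : ∀ i j, Y i j = Y j i) (Vs : Fin n → ℝ)
    {l : Fin n → ℝ} (hl : (hmat Y l).PosDef) (x : Fin n → ℝ) :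
    l ⬝ᵥ Pc Y Vs x = l ⬝ᵥ Pc Y Vs (phiv Y Vs l) -
      (x - phiv Y Vs l) ⬝ᵥ (hmat Y l *ᵥ (x - phiv Y Vs l)) := by
  have key : ∀ z : Fin n → ℝ, ∑ i, l i * z i * (Y *ᵥ Vs) i =
      2 * (z ⬝ᵥ (hmat Y l *ᵥ phiv Y Vs l)) := by
    intro z
    simp only [dotProduct, aux_phi Vs hl, Finset.mul_sum]
    refine Finset.sum_congr rfl fun j _ => ?_
    ring
  rw [aux_lp hY, aux_lp hY, key, key, mulVec_sub, dotProduct_sub, sub_dotProduct, sub_dotProduct,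
    aux_dot_sym (aux_hsym hY l) (phiv Y Vs l) x]
  ring

lemma aux_psd {A : Matrix (Fin n) (Fin n) ℝ} (hA : A.PosDef) (x : Fin n → ℝ) (hx : x ≠ 0) :
    0 < x ⬝ᵥ (A *ᵥ x) := by
  simpa using hA.dotProduct_mulVec_pos hx

lemma aux_psd0 {A : Matrix (Fin n) (Fin n) ℝ} (hA : A.PosDef) (x : Fin n → ℝ) :
    0 ≤ x ⬝ᵥ (A *ᵥ x) := by
  by_cases hx : x = 0
  · simp [hx]
  · exact (aux_psd hA x hx).le

lemma aux_phipos {Y : Matrix (Fin n) (Fin n) ℝ} (hPD : Y.PosDef) (hZ : IsZmat Y)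
    (hirr : IsIrred Y) (Vs : Fin n → ℝ) (hInn : ∀ i, 0 ≤ (Y *ᵥ Vs) i) (hIne : Y *ᵥ Vs ≠ 0)
    {l : Fin n → ℝ} (hl : (hmat Y l).PosDef) (hlp : ∀ i, 0 < l i) (i : Fin n) :
    0 < phiv Y Vs l i := by
  have hY := aux_sym hPD
  set p := phiv Y Vs l with hp
  have habs : (fun i => |p i|) = p := by
    by_contra hne
    have h1 := aux_exp hY Vs hl (fun i => |p i|)
    have h2 := aux_psd hl ((fun i => |p i|) - p) (sub_ne_zero.2 hne)
    have h3 := aux_abs (aux_hZ hZ hlp) p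
    rw [aux_lp hY, aux_lp hY, ← hp] at h1
    have h4 : ∑ i, l i * p i * (Y *ᵥ Vs) i ≤ ∑ i, l i * |p i| * (Y *ᵥ Vs) i := by
      refine Finset.sum_le_sum fun i _ => ?_
      exact mul_le_mul_of_nonneg_right
        (mul_le_mul_of_nonneg_left (le_abs_self _) (hlp i).le) (hInn i)
    linarith
  refine aux_Z (aux_hZ hZ hlp) (aux_hirr hirr hlp) p ?_ ?_ ?_ i
  · intro i; rw [← habs]; exact abs_nonneg _
  · intro i _
    rw [hp, aux_phi Vs hl]
    have := mul_nonneg (hlp i).le (hInn i)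
    linarith
  · intro h0
    apply hIne
    funext i
    have := aux_phi Vs hl i
    rw [← hp, h0] at this
    have h5 : l i * (Y *ᵥ Vs) i = 0 := by simp at this; simpa using this.symm
    simpa [(hlp i).ne'] using h5

lemma aux_cont (Y : Matrix (Fin n) (Fin n) ℝ) (Vs : Fin n → ℝ) : Continuous (Pc Y Vs) := by
  unfold Pc
  fun_prop

lemma aux_quad {a b M : ℝ} (h : ∀ t : ℝ, 0 ≤ t → t * a - t ^ 2 * b ≤ M) :
    0 ≤ b ∧ (b = 0 → a ≤ 0) := by
  have hb : 0 ≤ b := by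
    by_contra hb
    push Not at hb
    have h1 := h ((|a| + |M| + 1) / (-b) + 1) (by
      have : 0 ≤ (|a| + |M| + 1) / (-b) := div_nonneg (by positivity) (by linarith)
      linarith)
    set t := (|a| + |M| + 1) / (-b) + 1 with ht
    have h2 : (t - 1) * (-b) = |a| + |M| + 1 := by
      rw [ht, add_sub_cancel_right]; exact div_mul_cancel₀ _ (neg_ne_zero.2 hb.ne)
    have h3 : 1 ≤ t := by
      have : 0 ≤ (|a| + |M| + 1) / (-b) := div_nonneg (by positivity) (by linarith)
      linarith
    have h4 : |a| + |M| + 1 ≤ t * (-b) := by nlinarith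
    have h5 : |M| + 1 ≤ a + t * (-b) := by linarith [neg_abs_le a]
    have h6 : |M| + 1 ≤ t * (a + t * (-b)) := by nlinarith [abs_nonneg M]
    have := le_abs_self M
    nlinarith
  refine ⟨hb, fun h0 => ?_⟩
  by_contra ha
  push Not at ha
  have h1 := h ((|M| + 1) / a) (by positivity)
  rw [h0, div_mul_cancel₀ _ ha.ne'] at h1
  have := le_abs_self M
  linarith

lemma aux_bdd {Y : Matrix (Fin n) (Fin n) ℝ} (hPD : Y.PosDef) (hZ : IsZmat Y)
    (hirr : IsIrred Y) (Vs : Fin n → ℝ) (hInn : ∀ i, 0 ≤ (Y *ᵥ Vs) i) (hIne : Y *ᵥ Vs ≠ 0)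
    {l : Fin n → ℝ} (hl0 : l ≠ 0) {M : ℝ} (hM : ∀ P ∈ Fset Y Vs, l ⬝ᵥ P ≤ M) :
    (hmat Y l).PosDef ∧ ∀ i, 0 < l i := by
  have hY := aux_sym hPD
  have hYd : ∀ i, 0 < Y i i := fun i => hPD.diag_pos
  -- extend to nonnegative vectors
  have h1 : ∀ x : Fin n → ℝ, (∀ i, 0 ≤ x i) → l ⬝ᵥ Pc Y Vs x ≤ M := by
    intro x hx
    have hc : Continuous fun s : ℝ => l ⬝ᵥ Pc Y Vs (x + s • (fun _ => (1 : ℝ))) := by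
      have := aux_cont Y Vs
      fun_prop
    have hc' := (hc.tendsto 0).mono_left (nhdsWithin_le_nhds (s := Ioi (0 : ℝ)))
    simp only [zero_smul, add_zero] at hc'
    refine le_of_tendsto hc' ?_
    filter_upwards [self_mem_nhdsWithin] with s hs
    refine hM _ ⟨_, ?_, rfl⟩
    intro i
    have : 0 < s := hs
    have := hx i
    simp; linarith
  have h2 : ∀ x : Fin n → ℝ, (∀ i, 0 ≤ x i) → 0 ≤ x ⬝ᵥ (hmat Y l *ᵥ x) ∧
      (x ⬝ᵥ (hmat Y l *ᵥ x) = 0 → ∑ i, l i * x i * (Y *ᵥ Vs) i ≤ 0) := by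
    intro x hx
    refine aux_quad (M := M) fun t ht => ?_
    have h3 := h1 (t • x) (fun i => mul_nonneg ht (hx i))
    rw [aux_lp hY, mulVec_smul, dotProduct_smul, smul_dotProduct] at h3
    simp only [smul_eq_mul, Pi.smul_apply] at h3
    have h4 : ∑ i, l i * (t * x i) * (Y *ᵥ Vs) i = t * ∑ i, l i * x i * (Y *ᵥ Vs) i := by
      rw [Finset.mul_sum]
      refine Finset.sum_congr rfl fun j _ => ?_
      ring
    rw [h4] at h3
    linarith
  have hnn : ∀ i, 0 ≤ l i := by
    intro i
    have h3 := (h2 (Pi.single i 1) (fun j => by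
      by_cases h : j = i
      · subst h; simp
      · simp [h])).1
    rw [aux_q hY] at h3
    simp [Pi.single_apply] at h3
    have := hYd i
    by_contra hneg
    push Not at hneg
    nlinarith
  have hpos : ∀ i, 0 < l i := by
    by_contra hcon
    push Not at hcon
    obtain ⟨k, hk⟩ := hcon
    have hk0 : l k = 0 := le_antisymm hk (hnn k)
    obtain ⟨m, hm⟩ : ∃ m, l m ≠ 0 := by
      by_contra h; push Not at h; exact hl0 (funext h)
    obtain ⟨i, hi1, j, hj, hij⟩ := hirr (Finset.univ.filter fun i => l i = 0) ⟨k, by simp [hk0]⟩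
      (by intro h; have := Finset.mem_univ m; rw [← h] at this; simp at this; exact hm this)
    simp at hi1 hj
    have hne : i ≠ j := by rintro rfl; exact hj hi1
    have hlj : 0 < l j := lt_of_le_of_ne (hnn j) (Ne.symm hj)
    have hYij : Y i j < 0 := lt_of_le_of_ne (hZ i j hne) hij
    set s : ℝ := (Y j j + 1) / (- Y i j) with hs
    have hs0 : 0 ≤ s := div_nonneg (by linarith [hYd j]) (by linarith)
    have hsY : s * Y i j = - (Y j j + 1) := by
      rw [hs]; field_simp
    have h3 := (h2 (Pi.single i s + Pi.single j 1) (fun k => by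
      simp only [Pi.add_apply, Pi.single_apply]
      split_ifs <;> linarith)).1
    rw [aux_q hY] at h3
    have h4 : ∑ k, l k * (Pi.single i s + Pi.single j 1 : Fin n → ℝ) k *
        (Y *ᵥ (Pi.single i s + Pi.single j 1)) k = l j * (Y j i * s + Y j j) := by
      rw [Finset.sum_eq_single j]
      · simp [mulVec_add, hne.symm]; ring_nf; simp
      · intro k _ hkj
        by_cases hki : k = i
        · subst hki; simp [hi1]
        · simp [hki, hkj]
      · simp
    rw [h4, ← hY i j] at h3
    have : Y i j * s + Y j j = -1 := by linarith
    rw [this] at h3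
    linarith
  refine ⟨?_, hpos⟩
  have hHerm : (hmat Y l).IsHermitian := by
    ext i j
    simp [aux_hsym hY l i j]
  have hnn' : ∀ v : Fin n → ℝ, 0 ≤ v ⬝ᵥ (hmat Y l *ᵥ v) := fun v =>
    (h2 (fun i => |v i|) (fun i => abs_nonneg _)).1.trans (aux_abs (aux_hZ hZ hpos) v)
  have hPSD : (hmat Y l).PosSemidef :=
    .of_dotProduct_mulVec_nonneg hHerm fun v => by simpa using hnn' v
  refine .of_dotProduct_mulVec_pos hHerm fun v hv => ?_
  rw [star_trivial]
  refine lt_of_le_of_ne (hnn' v) fun h0 => ?_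
  set w : Fin n → ℝ := fun i => |v i| with hw
  have hw1 := h2 w (fun i => abs_nonneg _)
  have hw2 : w ⬝ᵥ (hmat Y l *ᵥ w) = 0 :=
    le_antisymm (by rw [h0]; exact aux_abs (aux_hZ hZ hpos) v) hw1.1
  have hw3 : hmat Y l *ᵥ w = 0 := (hPSD.dotProduct_mulVec_zero_iff w).1 (by simpa using hw2)
  have hw4 := aux_Z (aux_hZ hZ hpos) (aux_hirr hirr hpos) w (fun i => abs_nonneg _)
    (fun i _ => by rw [hw3]; simp) (by
      intro h
      apply hv
      funext i
      have := congrFun h i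
      simpa [hw] using this)
  have h5 := hw1.2 hw2
  obtain ⟨m, hm⟩ : ∃ m, (Y *ᵥ Vs) m ≠ 0 := by
    by_contra h; push Not at h; exact hIne (funext h)
  have h6 : 0 < ∑ i, l i * w i * (Y *ᵥ Vs) i := by
    refine Finset.sum_pos' (fun i _ => mul_nonneg (mul_nonneg (hnn i) (hw4 i).le) (hInn i))
      ⟨m, Finset.mem_univ _, ?_⟩
    exact mul_pos (mul_pos (hpos m) (hw4 m)) (lt_of_le_of_ne (hInn m) (Ne.symm hm))
  linarith

lemma aux_coer {A : Matrix (Fin n) (Fin n) ℝ} (hA : A.PosDef) :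
    ∃ c : ℝ, 0 < c ∧ ∀ d : Fin n → ℝ, c * ‖d‖ ^ 2 ≤ d ⬝ᵥ (A *ᵥ d) := by
  obtain ⟨c, hc, h⟩ := (isCompact_sphere (0 : Fin n → ℝ) 1).exists_forall_le'
    (f := fun d => d ⬝ᵥ (A *ᵥ d)) (by fun_prop) (a := 0) (fun d hd => aux_psd hA d (by
      rintro rfl; simp at hd))
  refine ⟨c, hc, fun d => ?_⟩
  by_cases hd : d = 0
  · simp [hd]
  have hd' : ‖d‖ ≠ 0 := norm_ne_zero_iff.2 hd
  have h1 := h (‖d‖⁻¹ • d) (by simp [norm_smul, hd'])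
  simp only [mulVec_smul, dotProduct_smul, smul_dotProduct, smul_eq_mul] at h1
  calc c * ‖d‖ ^ 2 ≤ (‖d‖⁻¹ * (‖d‖⁻¹ * d ⬝ᵥ (A *ᵥ d))) * ‖d‖ ^ 2 := by gcongr
    _ = _ := by field_simp

lemma aux_strong {Y : Matrix (Fin n) (Fin n) ℝ} (hY : ∀ i j, Y i j = Y j i) (Vs : Fin n → ℝ)
    {l : Fin n → ℝ} (hl : (hmat Y l).PosDef) (i : Fin n) {e : ℝ} (he : 0 < e) :
    ∃ M : ℝ, 0 ≤ M ∧ ∀ x, |Pc Y Vs x i - Pc Y Vs (phiv Y Vs l) i| ≤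
      e + M * (l ⬝ᵥ Pc Y Vs (phiv Y Vs l) - l ⬝ᵥ Pc Y Vs x) := by
  obtain ⟨c, hc, hcd⟩ := aux_coer hl
  set p := phiv Y Vs l with hp
  set K : ℝ := ∑ j, |Y i j| with hK
  have hK0 : 0 ≤ K := Finset.sum_nonneg fun j _ => abs_nonneg _
  set a : ℝ := |p i| * K + |(Y *ᵥ Vs) i - (Y *ᵥ p) i| with ha
  have ha0 : 0 ≤ a := by positivity
  refine ⟨(a ^ 2 / (4 * e) + K) / c, by positivity, fun x => ?_⟩
  rw [aux_exp hY Vs hl x, ← hp]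
  set d := x - p with hd
  have hx : x = p + d := by simp [hd]
  have hdi : |d i| ≤ ‖d‖ := norm_le_pi_norm d i
  have hYd : |(Y *ᵥ d) i| ≤ K * ‖d‖ := by
    simp only [mulVec, dotProduct, hK, Finset.sum_mul]
    refine (Finset.abs_sum_le_sum_abs _ _).trans (Finset.sum_le_sum fun j _ => ?_)
    rw [abs_mul]
    exact mul_le_mul_of_nonneg_left (norm_le_pi_norm d j) (abs_nonneg _)
  have h1 : Pc Y Vs x i - Pc Y Vs p i =
      - (p i * (Y *ᵥ d) i) + d i * ((Y *ᵥ Vs) i - (Y *ᵥ p) i) - d i * (Y *ᵥ d) i := by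
    rw [aux_pc, aux_pc, hx, mulVec_add]
    simp only [Pi.add_apply]
    ring
  have h2 : |Pc Y Vs x i - Pc Y Vs p i| ≤ a * ‖d‖ + K * ‖d‖ ^ 2 := by
    rw [h1]
    refine (abs_sub _ _).trans ?_
    have e1 := abs_add_le (-(p i * (Y *ᵥ d) i)) (d i * ((Y *ᵥ Vs) i - (Y *ᵥ p) i))
    rw [abs_neg, abs_mul, abs_mul] at e1
    rw [abs_mul (d i) ((Y *ᵥ d) i)]
    have e2 := mul_le_mul_of_nonneg_left hYd (abs_nonneg (p i))
    have e3 := mul_le_mul_of_nonneg_right hdi (abs_nonneg ((Y *ᵥ Vs) i - (Y *ᵥ p) i))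
    have e4 := mul_le_mul hdi hYd (abs_nonneg _) (norm_nonneg _)
    rw [ha]
    nlinarith
  have h3 : a * ‖d‖ ≤ e + a ^ 2 / (4 * e) * ‖d‖ ^ 2 := by
    have : e + a ^ 2 / (4 * e) * ‖d‖ ^ 2 - a * ‖d‖ = (2 * e - a * ‖d‖) ^ 2 / (4 * e) := by
      field_simp; ring
    have h' : 0 ≤ (2 * e - a * ‖d‖) ^ 2 / (4 * e) := by positivity
    linarith
  have h4 : (a ^ 2 / (4 * e) + K) * ‖d‖ ^ 2 ≤
      (a ^ 2 / (4 * e) + K) / c * (d ⬝ᵥ (hmat Y l *ᵥ d)) := by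
    calc (a ^ 2 / (4 * e) + K) * ‖d‖ ^ 2 = (a ^ 2 / (4 * e) + K) / c * (c * ‖d‖ ^ 2) := by
          field_simp
      _ ≤ _ := mul_le_mul_of_nonneg_left (hcd d) (by positivity)
  calc _ ≤ _ := h2
    _ ≤ e + (a ^ 2 / (4 * e) + K) * ‖d‖ ^ 2 := by linarith
    _ ≤ _ := by linarith

lemma aux_half {Y : Matrix (Fin n) (Fin n) ℝ} (hY : ∀ i j, Y i j = Y j i) (Vs : Fin n → ℝ)
    {l : Fin n → ℝ} (hl : (hmat Y l).PosDef) {p : Fin n → ℝ}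
    (hp : p ∈ closure (convexHull ℝ (Fset Y Vs))) :
    l ⬝ᵥ p ≤ l ⬝ᵥ Pc Y Vs (phiv Y Vs l) := by
  have hsub : convexHull ℝ (Fset Y Vs) ⊆ {y | l ⬝ᵥ y ≤ l ⬝ᵥ Pc Y Vs (phiv Y Vs l)} := by
    refine convexHull_min ?_ ?_
    · rintro _ ⟨x, _, rfl⟩
      have := aux_exp hY Vs hl x
      have := aux_psd0 hl (x - phiv Y Vs l)
      simp only [mem_setOf_eq]
      linarith
    · refine convex_halfSpace_le (f := fun y => l ⬝ᵥ y) ⟨fun x y => dotProduct_add _ _ _, fun c x => dotProduct_smul _ _ _⟩ _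
  refine closure_minimal hsub ?_ hp
  exact isClosed_le (by fun_prop) (by fun_prop)

lemma aux_exposed {Y : Matrix (Fin n) (Fin n) ℝ} (hY : ∀ i j, Y i j = Y j i) (Vs : Fin n → ℝ)
    {l : Fin n → ℝ} (hl : (hmat Y l).PosDef) {p : Fin n → ℝ}
    (hp : p ∈ closure (convexHull ℝ (Fset Y Vs)))
    (hlp : l ⬝ᵥ Pc Y Vs (phiv Y Vs l) ≤ l ⬝ᵥ p) : p = Pc Y Vs (phiv Y Vs l) := by
  funext i
  set q := Pc Y Vs (phiv Y Vs l) with hq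
  have key : ∀ e : ℝ, 0 < e → |p i - q i| ≤ e := by
    intro e he
    obtain ⟨M, hM0, hM⟩ := aux_strong hY Vs hl i he
    rw [← hq] at hM
    have hsub : convexHull ℝ (Fset Y Vs) ⊆ {y | |y i - q i| ≤ e + M * (l ⬝ᵥ q - l ⬝ᵥ y)} := by
      refine convexHull_min ?_ ?_
      · rintro _ ⟨x, _, rfl⟩
        exact hM x
      · intro y hy z hz a b ha hb hab
        simp only [mem_setOf_eq] at hy hz ⊢
        rw [dotProduct_add, dotProduct_smul, dotProduct_smul]
        simp only [Pi.add_apply, Pi.smul_apply, smul_eq_mul]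
        have hb' : b = 1 - a := by linarith
        rw [abs_le] at hy hz ⊢
        have y1 := mul_le_mul_of_nonneg_left hy.1 ha
        have y2 := mul_le_mul_of_nonneg_left hy.2 ha
        have z1 := mul_le_mul_of_nonneg_left hz.1 hb
        have z2 := mul_le_mul_of_nonneg_left hz.2 hb
        subst hb'
        constructor <;> linarith
    have h1 := closure_minimal hsub
      (isClosed_le (by fun_prop) (by fun_prop)) hp
    simp only [mem_setOf_eq] at h1
    have := mul_nonpos_of_nonneg_of_nonpos hM0 (sub_nonpos.2 hlp)
    linarith
  have h0 : |p i - q i| ≤ 0 := le_of_forall_pos_le_add fun e he => by simpa using key e he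
  have := abs_nonpos_iff.1 h0
  linarith

lemma aux_dual (f : (Fin n → ℝ) →ₗ[ℝ] ℝ) (x : Fin n → ℝ) :
    f x = (fun i => f (Pi.single i 1)) ⬝ᵥ x := by
  conv_lhs => rw [LinearMap.pi_apply_eq_sum_univ f x]
  simp only [dotProduct, smul_eq_mul]
  refine Finset.sum_congr rfl fun i _ => ?_
  rw [mul_comm]
  congr 2
  funext j
  simp [Pi.single_apply, eq_comm]

lemma aux_int {Y : Matrix (Fin n) (Fin n) ℝ} (hPD : Y.PosDef) (hZ : IsZmat Y)
    (hn : 1 ≤ n)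
    (hirr : IsIrred Y) (Vs : Fin n → ℝ) (hInn : ∀ i, 0 ≤ (Y *ᵥ Vs) i) (hIne : Y *ᵥ Vs ≠ 0) :
    (interior (convexHull ℝ (Fset Y Vs))).Nonempty := by
  rw [interior_convexHull_nonempty_iff_affineSpan_eq_top]
  have hmem : Pc Y Vs (fun _ => 1) ∈ Fset Y Vs := ⟨_, fun _ => one_pos, rfl⟩
  by_contra hne
  have hdir : (affineSpan ℝ (Fset Y Vs)).direction ≠ ⊤ := by
    intro h
    exact hne ((AffineSubspace.direction_eq_top_iff_of_nonempty
      ⟨_, subset_affineSpan ℝ _ hmem⟩).1 h)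
  obtain ⟨f, hf0, hf⟩ := Submodule.exists_le_ker_of_lt_top _ hdir.lt_top
  have hconst : ∀ P ∈ Fset Y Vs, f P = f (Pc Y Vs (fun _ => 1)) := by
    intro P hP
    have := hf (AffineSubspace.vsub_mem_direction (subset_affineSpan ℝ _ hP)
      (subset_affineSpan ℝ _ hmem))
    simp only [vsub_eq_sub, LinearMap.mem_ker, map_sub] at this
    linarith
  set l : Fin n → ℝ := fun i => f (Pi.single i 1) with hl
  have hl0 : l ≠ 0 := by
    intro h
    apply hf0
    ext x
    simp
    exact congrFun h x
  have h1 := (aux_bdd hPD hZ hirr Vs hInn hIne hl0 (M := f (Pc Y Vs (fun _ => 1)))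
    (fun P hP => by rw [← aux_dual, hconst P hP])).2 ⟨0, hn⟩
  have h2 := (aux_bdd hPD hZ hirr Vs hInn hIne (neg_ne_zero.2 hl0)
    (M := - f (Pc Y Vs (fun _ => 1)))
    (fun P hP => by rw [neg_dotProduct, ← aux_dual, hconst P hP])).2 ⟨0, hn⟩
  simp at h2
  linarith

/-- points of the closure that are not interior are attained -/
lemma aux_bdry {Y : Matrix (Fin n) (Fin n) ℝ} (hPD : Y.PosDef) (hZ : IsZmat Y)
    (hn : 1 ≤ n)
    (hirr : IsIrred Y) (Vs : Fin n → ℝ) (hInn : ∀ i, 0 ≤ (Y *ᵥ Vs) i) (hIne : Y *ᵥ Vs ≠ 0)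
    {p : Fin n → ℝ} (hp : p ∈ closure (convexHull ℝ (Fset Y Vs)))
    (hpi : p ∉ interior (convexHull ℝ (Fset Y Vs))) :
    ∃ l ∈ Lam1 Y, Pc Y Vs (phiv Y Vs l) = p := by
  have hY := aux_sym hPD
  have hcv : Convex ℝ (convexHull ℝ (Fset Y Vs)) := convex_convexHull _ _
  have hne := aux_int hPD hZ hn hirr Vs hInn hIne
  obtain ⟨f, hf⟩ := geometric_hahn_banach_open_point hcv.interior isOpen_interior hpi
  have hle : ∀ y ∈ closure (convexHull ℝ (Fset Y Vs)), f y ≤ f p := by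
    rw [← hcv.closure_interior_eq_closure_of_nonempty_interior hne]
    intro y hy
    exact closure_minimal (t := {y | f y ≤ f p}) (fun a ha => (hf a ha).le)
      (isClosed_le (by fun_prop) (by fun_prop)) hy
  set l : Fin n → ℝ := fun i => f (Pi.single i 1) with hl
  have hfl : ∀ x, f x = l ⬝ᵥ x := fun x => aux_dual (f : (Fin n → ℝ) →ₗ[ℝ] ℝ) x
  have hl0 : l ≠ 0 := by
    intro h
    obtain ⟨a, ha⟩ := hne
    have := hf a ha
    rw [hfl, hfl, h] at this
    simp at this
  have hsub : Fset Y Vs ⊆ closure (convexHull ℝ (Fset Y Vs)) :=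
    (subset_convexHull ℝ _).trans subset_closure
  have hpos0 := (aux_bdd hPD hZ hirr Vs hInn hIne hl0 (M := f p)
    (fun P hP => by rw [← hfl]; exact hle P (hsub hP))).2
  set S := ∑ i, l i with hS
  have hSpos : 0 < S := Finset.sum_pos (fun i _ => hpos0 i) ⟨⟨0, hn⟩, Finset.mem_univ _⟩
  set m : Fin n → ℝ := S⁻¹ • l with hm
  have hm0 : m ≠ 0 := smul_ne_zero (inv_ne_zero hSpos.ne') hl0
  have hmle : ∀ y ∈ closure (convexHull ℝ (Fset Y Vs)), m ⬝ᵥ y ≤ m ⬝ᵥ p := by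
    intro y hy
    rw [hm, smul_dotProduct, smul_dotProduct, ← hfl, ← hfl]
    exact mul_le_mul_of_nonneg_left (hle y hy) (by positivity)
  obtain ⟨hmPD, hmpos⟩ := aux_bdd hPD hZ hirr Vs hInn hIne hm0 (M := m ⬝ᵥ p)
    (fun P hP => hmle P (hsub hP))
  refine ⟨m, ⟨hmPD, hmpos, ?_⟩, ?_⟩
  · simp only [hm, Pi.smul_apply, smul_eq_mul, ← Finset.mul_sum, ← hS]
    exact inv_mul_cancel₀ hSpos.ne'
  · refine (aux_exposed hY Vs hmPD hp (hmle _ (hsub ⟨_, ?_, rfl⟩))).symm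
    exact aux_phipos hPD hZ hirr Vs hInn hIne hmPD hmpos

lemma aux_inj {Y : Matrix (Fin n) (Fin n) ℝ} (hPD : Y.PosDef) (hZ : IsZmat Y)
    (hn : 1 ≤ n)
    (hirr : IsIrred Y) (Vs : Fin n → ℝ) (hInn : ∀ i, 0 ≤ (Y *ᵥ Vs) i) (hIne : Y *ᵥ Vs ≠ 0) :
    Set.InjOn (fun l => Pc Y Vs (phiv Y Vs l)) (Lam1 Y) := by
  rintro l ⟨hl, hlp, hls⟩ m ⟨hm, hmp, hms⟩ heq
  have hY := aux_sym hPD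
  simp only at heq
  have hx : phiv Y Vs m = phiv Y Vs l := by
    by_contra hne
    have h1 := aux_exp hY Vs hl (phiv Y Vs m)
    have h2 := aux_psd hl _ (sub_ne_zero.2 hne)
    rw [heq] at h1
    linarith
  have hxp := aux_phipos hPD hZ hirr Vs hInn hIne hl hlp
  have h1 := aux_phi Vs hl
  have h2 := aux_phi Vs hm
  rw [hx] at h2
  set x := phiv Y Vs l with hxdef
  simp only [aux_hmul] at h1 h2
  haveI : Nonempty (Fin n) := ⟨⟨0, hn⟩⟩
  obtain ⟨k, hk⟩ := Finite.exists_min (fun i => m i / l i)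
  set t := m k / l k with ht
  set w : Fin n → ℝ := fun i => (m i - t * l i) * x i with hw
  have hYw : ∀ i, (Y *ᵥ w) i = (m i - t * l i) * ((Y *ᵥ Vs) i - (Y *ᵥ x) i) := by
    intro i
    have e : w = (fun j => m j * x j) - t • (fun j => l j * x j) := by
      funext j; simp [hw]; ring
    rw [e, mulVec_sub, mulVec_smul]
    simp only [Pi.sub_apply, Pi.smul_apply, smul_eq_mul]
    have e1 := h1 i
    have e2 := h2 i
    have e1' : (Y *ᵥ (fun j => l j * x j)) i = l i * ((Y *ᵥ Vs) i - (Y *ᵥ x) i) := by linarith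
    have e2' : (Y *ᵥ (fun j => m j * x j)) i = m i * ((Y *ᵥ Vs) i - (Y *ᵥ x) i) := by linarith
    rw [e1', e2']; ring
  have hw0 : w = 0 := by
    by_contra hne
    have := aux_Z hZ hirr w (fun i => by
      refine mul_nonneg ?_ (hxp i).le
      have := hk i
      rw [le_div_iff₀ (hlp i)] at this
      linarith) (fun i hi => by
        rw [hYw]
        have : m i - t * l i = 0 := by
          rcases mul_eq_zero.1 hi with h | h
          · exact h
          · exact absurd h (hxp i).ne'
        rw [this]; simp) hne k
    have hz : w k = 0 := by
      simp only [hw, ht]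
      rw [div_mul_cancel₀ _ (hlp k).ne']; simp
    linarith
  have hmt : ∀ i, m i = t * l i := by
    intro i
    have := congrFun hw0 i
    rcases mul_eq_zero.1 this with h | h
    · linarith
    · exact absurd h (hxp i).ne'
  have ht1 : t = 1 := by
    have : ∑ i, m i = t * ∑ i, l i := by
      rw [Finset.mul_sum]; exact Finset.sum_congr rfl fun i _ => hmt i
    rw [hls, hms] at this
    linarith
  funext i
  rw [hmt i, ht1, one_mul]

lemma aux_notint {Y : Matrix (Fin n) (Fin n) ℝ} (hY : ∀ i j, Y i j = Y j i) (Vs : Fin n → ℝ)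
    (hn : 1 ≤ n) {l : Fin n → ℝ} (hl : (hmat Y l).PosDef) (hlp : ∀ i, 0 < l i) :
    Pc Y Vs (phiv Y Vs l) ∉ interior (convexHull ℝ (Fset Y Vs)) := by
  intro hint
  set q := Pc Y Vs (phiv Y Vs l) with hq
  have hc : Continuous fun s : ℝ => q + s • l := by fun_prop
  have h1 : ∀ᶠ s in nhdsWithin (0 : ℝ) (Ioi 0), q + s • l ∈ interior (convexHull ℝ (Fset Y Vs)) := by
    refine ((hc.tendsto 0).mono_left nhdsWithin_le_nhds).eventually ?_
    refine isOpen_interior.mem_nhds ?_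
    simpa using hint
  obtain ⟨s, hs, hs0⟩ := (h1.and self_mem_nhdsWithin).exists
  have h2 := aux_half hY Vs hl (subset_closure (interior_subset hs))
  rw [← hq, dotProduct_add, dotProduct_smul] at h2
  have h3 : 0 < l ⬝ᵥ l :=
    Finset.sum_pos (fun i _ => mul_pos (hlp i) (hlp i)) ⟨⟨0, hn⟩, Finset.mem_univ _⟩
  have h4 : 0 < s * (l ⬝ᵥ l) := mul_pos hs0 h3
  simp only [smul_eq_mul] at h2
  linarith

end helpers

theorem stmt_13 (n : ℕ) (hn : 1 ≤ n)
    (Y : Matrix (Fin n) (Fin n) ℝ)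
    (hPD : Y.PosDef)
    (hZ : IsZmat Y)
    (hirr : IsIrred Y)
    (Vs : Fin n → ℝ) (hVs : ∀ i, 0 < Vs i)
    (hInn : ∀ i, 0 ≤ (Y *ᵥ Vs) i) (hIne : Y *ᵥ Vs ≠ 0) :
    Set.InjOn (fun l => Pc Y Vs (phiv Y Vs l)) (Lam1 Y) ∧
    (fun l => Pc Y Vs (phiv Y Vs l)) '' Lam1 Y = frontier (convexHull ℝ (Fset Y Vs)) ∧
    IsClosed (convexHull ℝ (Fset Y Vs)) := by
  have hY := aux_sym hPD
  have hcl : IsClosed (convexHull ℝ (Fset Y Vs)) := by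
    refine isClosed_of_closure_subset fun p hp => ?_
    by_cases hpi : p ∈ interior (convexHull ℝ (Fset Y Vs))
    · exact interior_subset hpi
    · obtain ⟨l, ⟨hl, hlp, _⟩, rfl⟩ := aux_bdry hPD hZ hn hirr Vs hInn hIne hp hpi
      exact subset_convexHull ℝ _ ⟨_, aux_phipos hPD hZ hirr Vs hInn hIne hl hlp, rfl⟩
  refine ⟨aux_inj hPD hZ hn hirr Vs hInn hIne, ?_, hcl⟩
  ext p
  constructor
  · rintro ⟨l, ⟨hl, hlp, _⟩, rfl⟩
    refine ⟨subset_closure (subset_convexHull ℝ _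
      ⟨_, aux_phipos hPD hZ hirr Vs hInn hIne hl hlp, rfl⟩), aux_notint hY Vs hn hl hlp⟩
  · rintro ⟨hp, hpi⟩
    obtain ⟨l, hl, h⟩ := aux_bdry hPD hZ hn hirr Vs hInn hIne hp hpi
    exact ⟨l, hl, h⟩
end
end
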